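/- arXiv:0706.2484 — 4 statements merged into one kernel-verified Lean document; each statement's English description precedes it below -/
import Mathlib

section
/- For integers n ≥ 4 and 1 < m < n−1, let f_{m,n} : [1,n] → [1,n] be the continuous map with f_{m,n}(1) = m+1, f_{m,n}(2) = 1, f_{m,n}(m) = m−1, f_{m,n}(m+1) = m+2, f_{m,n}(n−1) = n, f_{m,n}(n) = m, and f_{m,n} affine on each of the intervals [1,2], [2,m], [m,m+1], [m+1,n−1], [n−1,n]. Then for every positive integer k, the set {x ∈ [1,n] : f_{m,n}^k(x) = x} is finite and has exactly a_{n,k} elements; in particular this number is independent of m for 1 < m < n−1. -/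
/-- `f` is affine (linear interpolation between its endpoint values) on `[a, b]`. -/
def AffOn (f : ℝ → ℝ) (a b : ℝ) : Prop :=
  ∀ x ∈ Set.Icc a b, f x = f a + (x - a) * (f b - f a) / (b - a)

open Matrix

theorem Matrix.pow_apply_eq_sum_walks {V R : Type*} [Fintype V] [DecidableEq V] [CommSemiring R]
    (A : Matrix V V R) (k : ℕ) (i j : V) :
    (A ^ k) i j = ∑ w : Fin (k + 1) → V, if w 0 = i ∧ w (Fin.last k) = j then
      ∏ t : Fin k, A (w t.castSucc) (w t.succ) else 0 := by
  induction k generalizing i with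
  | zero =>
    rw [← (Equiv.funUnique (Fin 1) V).symm.sum_comp]
    by_cases h : i = j
    · subst h
      simp
    · have : ∀ x : V, ¬ (x = i ∧ x = j) := by rintro x ⟨rfl, rfl⟩; exact h rfl
      simp [h, this]
  | succ k ih =>
    rw [pow_succ', Matrix.mul_apply]
    symm
    rw [← (Fin.consEquiv fun _ => V).sum_comp, Fintype.sum_prod_type, Finset.sum_eq_single i]
    · simp_rw [ih, Finset.mul_sum]
      rw [Finset.sum_comm]
      refine Finset.sum_congr rfl fun w _ => ?_
      rw [Finset.sum_eq_single (w 0)]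
      · simp [Fin.consEquiv, Fin.prod_univ_succ, ← Fin.succ_last]
      · intro b _ hb
        simp [hb.symm]
      · simp
    · intro b _ hb
      simp [Fin.consEquiv, hb]
    · simp

theorem Matrix.trace_pow_eq_card_closed_walks {V : Type*} [Fintype V] [DecidableEq V]
    (E : V → V → Prop) [DecidableRel E] (k : ℕ) :
    trace ((Matrix.of fun i j => if E i j then (1 : ℤ) else 0) ^ k) =
      ({w : Fin (k + 1) → V | w 0 = w (Fin.last k) ∧
        ∀ t : Fin k, E (w t.castSucc) (w t.succ)}.ncard : ℤ) := by
  classical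
  simp_rw [trace, diag_apply, Matrix.pow_apply_eq_sum_walks]
  rw [Finset.sum_comm, Set.ncard_eq_toFinset_card', Finset.card_eq_sum_ones, Nat.cast_sum,
    Set.toFinset_ofPred, Finset.sum_filter]
  refine Finset.sum_congr rfl fun w _ => ?_
  rw [Finset.sum_eq_single (w 0)]
  · by_cases h : w 0 = w (Fin.last k)
    · simp [h, Finset.prod_ite_zero]
    · simp [h, Ne.symm h]
  · intro b _ hb
    simp [hb.symm]
  · simp

theorem sum_Icc_sub_eq_sum_range (g : ℕ → ℤ) (N d : ℕ) :
    ∑ i ∈ Finset.Icc 2 (N + 1), g (N + 2 + d - i) = ∑ j ∈ Finset.range N, g (d + 1 + j) := by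
  refine Finset.sum_nbij' (fun i => N + 1 - i) (fun j => N + 1 - j) ?_ ?_ ?_ ?_ ?_
  · intro i hi; simp at hi ⊢; omega
  · intro i hi; simp at hi ⊢; omega
  · intro i hi; simp at hi ⊢; omega
  · intro i hi; simp at hi ⊢; omega
  · intro i hi
    simp only [Finset.mem_Icc] at hi
    congr 1
    omega

theorem eq_sum_of_four_term_recurrence {N : ℕ} {b : ℕ → ℤ} (hb0 : b 0 = N + 2)
    (hlow : ∀ k, 0 < k → k < N + 2 → b k = 2 ^ (k + 1))
    (hrec : ∀ d, b (N + 2 + d) = 4 * b (N + 1 + d) - 4 * b (N + d) + b d)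
    (hN : 0 < N) (d : ℕ) :
    b (N + 2 + d) = 3 * b (N + 1 + d) - ∑ j ∈ Finset.range N, b (d + 1 + j) + N - 2 := by
  induction d with
  | zero =>
    have hs : ∀ M ≤ N, ∑ j ∈ Finset.range M, b (0 + 1 + j) = 2 ^ (M + 2) - 4 := by
      intro M hM
      induction M with
      | zero => simp
      | succ M ih =>
        rw [Finset.sum_range_succ, ih (by omega), hlow _ (by omega) (by omega)]
        ring
    rw [hrec, hs N le_rfl, hlow (N + 1 + 0) (by omega) (by omega),
      hlow (N + 0) (by omega) (by omega), hb0]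
    simp only [add_zero]
    ring
  | succ d ih =>
    have h1 : ∑ j ∈ Finset.range N, b (d + 1 + 1 + j) + b (d + 1) =
        ∑ j ∈ Finset.range N, b (d + 1 + j) + b (d + 1 + N) := by
      rw [← Finset.sum_range_succ, Finset.sum_range_succ']
      simp only [add_zero, add_left_inj]
      exact Finset.sum_congr rfl fun j _ => by congr 1; omega
    rw [hrec (d + 1)]
    rw [show N + 2 + d = N + 1 + (d + 1) by omega] at ih
    rw [show d + 1 + N = N + (d + 1) by omega] at h1
    rw [show N + 1 + d = N + (d + 1) by omega] at ih
    linarith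

theorem eq_sub_one_of_recurrences {n : ℕ} (hn : 4 ≤ n) {a b : ℕ → ℤ} (hb0 : b 0 = n)
    (hlow : ∀ k, 0 < k → k < n → b k = 2 ^ (k + 1))
    (hrec : ∀ k, n ≤ k → b k = 4 * b (k - 1) - 4 * b (k - 2) + b (k - n))
    (haLow : ∀ k : ℕ, 1 ≤ k → k ≤ n - 1 → a k = 2 ^ (k + 1) - 1)
    (haRec : ∀ k : ℕ, n ≤ k →
      a k = 3 * a (k - 1) - ∑ i ∈ Finset.Icc 2 (n - 1), a (k - i))
    (k : ℕ) (hk : 0 < k) : a k = b k - 1 := by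
  obtain ⟨N, rfl⟩ := Nat.exists_eq_add_of_le' (show 2 ≤ n by omega)
  have key := eq_sum_of_four_term_recurrence (N := N) (b := b) (by simpa using hb0) hlow
    (fun d => by
      rw [hrec _ (Nat.le_add_right _ _)]
      congr 3
      · congr 2; omega
      · congr 2; omega
      · omega)
    (by omega)
  induction k using Nat.strong_induction_on with
  | _ k ih =>
    by_cases h : k < N + 2
    · rw [haLow k hk (by omega), hlow k hk h]
    · obtain ⟨d, rfl⟩ := Nat.exists_eq_add_of_le (not_lt.1 h)
      rw [haRec _ (by omega), show N + 2 - 1 = N + 1 by omega, sum_Icc_sub_eq_sum_range, key,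
        show N + 2 + d - 1 = N + 1 + d by omega, ih _ (by omega) (by omega)]
      rw [Finset.sum_congr rfl fun j hj => ih (d + 1 + j)
        (by simp only [Finset.mem_range] at hj; omega) (by omega)]
      simp only [Finset.sum_sub_distrib, Finset.sum_const, Finset.card_range, nsmul_eq_mul]
      ring

section Counting

theorem sum_mul_two_deltas {ι R : Type*} [Fintype ι] [DecidableEq ι] [CommSemiring R]
    (g F : ι → R) (a b : ι) (c : R)
    (h : ∀ j, F j = (if j = a then 1 else 0) + (if j = b then c else 0)) :
    ∑ j, g j * F j = g a + g b * c := by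
  simp [h, mul_add, Finset.sum_add_distrib]

/-- Transition relation of the Markov partition `[1,2], …, [n-1,n]`. -/
def Edge (n m i j : ℕ) : Prop :=
  (i = 1 ∧ j ≤ m) ∨ (1 < i ∧ i < m ∧ j + 1 = i) ∨ (i = m ∧ m ≤ j + 1 ∧ j ≤ m + 1) ∨
    (m < i ∧ i + 1 < n ∧ j = i + 1) ∨ (i + 1 = n ∧ m ≤ j)

instance (n m : ℕ) : DecidableRel (Edge n m) := fun i j => by
  unfold Edge; infer_instance

/-- The cell `i` stands for the interval `[i,i+1]`. -/
abbrev Cell (n : ℕ) : Type := Finset.Ico 1 n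

/-- Adjacency matrix of the transition relation. -/
def transferMatrix (n m : ℕ) : Matrix (Cell n) (Cell n) ℤ :=
  of fun i j => if Edge n m i j then 1 else 0

/-- The cyclic shift on `Fin n` plus twice the projection onto the coordinates `m-1` and `n-1`. -/
def cycleMatrix (n m : ℕ) : Matrix (Fin n) (Fin n) ℤ :=
  of fun r q => (if (r : ℕ) + 1 = q ∨ ((r : ℕ) + 1 = n ∧ (q : ℕ) = 0) then 1 else 0) +
    if (r : ℕ) = q ∧ ((r : ℕ) + 1 = m ∨ (r : ℕ) + 1 = n) then 2 else 0

/-- Intertwines `cycleMatrix` with `transferMatrix`. -/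
def toCells (n m : ℕ) : Matrix (Fin n) (Cell n) ℤ :=
  of fun r j => if ((r : ℕ) + 1 < m ∧ (j : ℕ) + r + 1 = m) ∨ ((r : ℕ) + 1 = m ∧ (j : ℕ) ≤ m) ∨
    (m ≤ (r : ℕ) ∧ (r : ℕ) + 1 < n ∧ (j : ℕ) = r + 1) ∨ ((r : ℕ) + 1 = n ∧ m ≤ (j : ℕ)) then 1 else 0

/-- A left inverse of `toCells`. -/
def ofCells (n m : ℕ) : Matrix (Cell n) (Fin n) ℤ :=
  of fun i r => (if ((i : ℕ) < m ∧ (i : ℕ) + r + 1 = m) ∨ (m < (i : ℕ) ∧ (r : ℕ) + 1 = i) ∨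
    ((i : ℕ) = m ∧ (r : ℕ) + 1 = m) then 1 else 0) -
    if (i : ℕ) = m ∧ (r : ℕ) + 1 < m then 1 else 0

/-- The left fixed vector of `cycleMatrix` that `toCells` sends to zero. -/
def kernelVec (n m : ℕ) : Fin n → ℤ :=
  fun r => if (r : ℕ) + 1 < m ∨ (r : ℕ) + 1 = n then 1 else -1

variable {n m : ℕ}

theorem mul_cycleMatrix_apply {ι : Type*} (hm1 : 1 < m)
    (M : Matrix ι (Fin n) ℤ) (r : ι) (q q' : Fin n)
    (hq : (q' : ℕ) + 1 = q ∨ ((q' : ℕ) + 1 = n ∧ (q : ℕ) = 0)) :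
    (M * cycleMatrix n m) r q =
      M r q' + M r q * (if (q : ℕ) + 1 = m ∨ (q : ℕ) + 1 = n then 2 else 0) := by
  rw [Matrix.mul_apply]
  refine sum_mul_two_deltas _ _ q' q _ fun j => ?_
  simp only [cycleMatrix, of_apply, Fin.ext_iff]
  split_ifs <;> omega

theorem cycleMatrix_mul_apply {ι : Type*} (hm1 : 1 < m)
    (M : Matrix (Fin n) ι ℤ) (r r' : Fin n) (q : ι)
    (hr : (r : ℕ) + 1 = r' ∨ ((r : ℕ) + 1 = n ∧ (r' : ℕ) = 0)) :
    (cycleMatrix n m * M) r q =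
      M r' q + M r q * (if (r : ℕ) + 1 = m ∨ (r : ℕ) + 1 = n then 2 else 0) := by
  rw [Matrix.mul_apply]
  simp_rw [mul_comm (cycleMatrix n m r _)]
  refine sum_mul_two_deltas (fun j => M j q) _ r' r _ fun j => ?_
  simp only [cycleMatrix, of_apply, Fin.ext_iff]
  split_ifs <;> omega

theorem exists_cyclic_pred (hn : 0 < n) (q : Fin n) :
    ∃ q' : Fin n, (q' : ℕ) + 1 = q ∨ ((q' : ℕ) + 1 = n ∧ (q : ℕ) = 0) := by
  by_cases h : (q : ℕ) = 0
  · exact ⟨⟨n - 1, by omega⟩, Or.inr ⟨by simp; omega, h⟩⟩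
  · exact ⟨⟨q - 1, by omega⟩, Or.inl (by simp; omega)⟩

theorem exists_cyclic_succ (hn : 0 < n) (r : Fin n) :
    ∃ r' : Fin n, (r : ℕ) + 1 = r' ∨ ((r : ℕ) + 1 = n ∧ (r' : ℕ) = 0) := by
  by_cases h : (r : ℕ) + 1 = n
  · exact ⟨⟨0, hn⟩, Or.inr ⟨h, rfl⟩⟩
  · exact ⟨⟨r + 1, by omega⟩, Or.inl rfl⟩

theorem mul_transferMatrix_apply {ι : Type*} (hm1 : 1 < m) (hm2 : m < n - 1)
    (M : Matrix ι (Cell n) ℤ) (r : ι) (l : Cell n) :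
    (M * transferMatrix n m) r l =
      (if h : (l : ℕ) < m then M r ⟨1, by simp; omega⟩ + M r ⟨l + 1, by simp; omega⟩ else
        M r ⟨n - 1, by simp; omega⟩ +
        if h' : (l : ℕ) = m then M r ⟨1, by simp; omega⟩ + M r l else
          M r ⟨l - 1, by have := Finset.mem_Ico.1 l.2; simp; omega⟩) := by
  obtain ⟨l, hl⟩ := l
  have hl' := Finset.mem_Ico.1 hl
  rw [Matrix.mul_apply]
  have key : ∀ (a b c : Cell n) (d : ℤ), (∀ j, transferMatrix n m j ⟨l, hl⟩ =
      (if j = a then 1 else 0) + (if j = b then 1 else 0) + (if j = c then d else 0)) →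
      ∑ j, M r j * transferMatrix n m j ⟨l, hl⟩ = M r a + M r b + M r c * d := by
    intro a b c d h
    simp [h, mul_add, Finset.sum_add_distrib]
  dsimp only
  split_ifs with h h'
  · rw [key ⟨1, by simp; omega⟩ ⟨l + 1, by simp; omega⟩ ⟨1, by simp; omega⟩ 0]
    · ring
    · rintro ⟨j, hj⟩
      have hj' := Finset.mem_Ico.1 hj
      simp only [transferMatrix, Edge, of_apply, Subtype.ext_iff]
      split_ifs <;> omega
  · rw [key ⟨n - 1, by simp; omega⟩ ⟨1, by simp; omega⟩ ⟨l, hl⟩ 1]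
    · ring
    · rintro ⟨j, hj⟩
      have hj' := Finset.mem_Ico.1 hj
      simp only [transferMatrix, Edge, of_apply, Subtype.ext_iff]
      split_ifs <;> omega
  · rw [key ⟨n - 1, by simp; omega⟩ ⟨l - 1, by simp; omega⟩ ⟨l, hl⟩ 0]
    · ring
    · rintro ⟨j, hj⟩
      have hj' := Finset.mem_Ico.1 hj
      simp only [transferMatrix, Edge, of_apply, Subtype.ext_iff]
      split_ifs <;> omega

theorem toCells_of_lt {r : Fin n} (h : (r : ℕ) + 1 < m) (hm2 : m < n - 1) (j : Cell n) :
    toCells n m r j = if (j : ℕ) + r + 1 = m then 1 else 0 := by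
  simp only [toCells, of_apply]
  congr 1
  simp only [eq_iff_iff]
  omega

theorem toCells_of_eq {r : Fin n} (h : (r : ℕ) + 1 = m) (hm2 : m < n - 1) (j : Cell n) :
    toCells n m r j = if (j : ℕ) ≤ m then 1 else 0 := by
  simp only [toCells, of_apply]
  congr 1
  simp only [eq_iff_iff]
  omega

theorem toCells_of_ge {r : Fin n} (h : m ≤ (r : ℕ)) (h' : (r : ℕ) + 1 < n) (j : Cell n) :
    toCells n m r j = if (j : ℕ) = r + 1 then 1 else 0 := by
  simp only [toCells, of_apply]
  congr 1
  simp only [eq_iff_iff]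
  omega

theorem toCells_last {r : Fin n} (h : (r : ℕ) + 1 = n) (hm2 : m < n - 1) (j : Cell n) :
    toCells n m r j = if m ≤ (j : ℕ) then 1 else 0 := by
  simp only [toCells, of_apply]
  congr 1
  simp only [eq_iff_iff]
  omega

theorem toCells_mul_transferMatrix (hm1 : 1 < m) (hm2 : m < n - 1) :
    toCells n m * transferMatrix n m = cycleMatrix n m * toCells n m := by
  ext r l
  obtain ⟨r', hr'⟩ := exists_cyclic_succ (by omega) r
  rw [mul_transferMatrix_apply hm1 hm2, cycleMatrix_mul_apply hm1 _ r r' l hr']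
  have hl := Finset.mem_Ico.1 l.2
  have hr := r.2
  obtain h | h | h | h | h | h : ((r : ℕ) + 2 < m) ∨ ((r : ℕ) + 2 = m) ∨ ((r : ℕ) + 1 = m) ∨
    (m ≤ (r : ℕ) ∧ (r : ℕ) + 2 < n) ∨ (m ≤ (r : ℕ) ∧ (r : ℕ) + 2 = n) ∨ ((r : ℕ) + 1 = n) := by
    omega
  · rw [if_neg (by omega)]
    simp only [toCells_of_lt (r := r) (m := m) (by omega) hm2,
      toCells_of_lt (r := r') (m := m) (by omega) hm2]
    split_ifs <;> omega
  · rw [if_neg (by omega)]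
    simp only [toCells_of_lt (r := r) (m := m) (by omega) hm2,
      toCells_of_eq (r := r') (m := m) (by omega) hm2]
    split_ifs <;> omega
  · rw [if_pos (by omega)]
    simp only [toCells_of_eq (r := r) (m := m) (by omega) hm2,
      toCells_of_ge (r := r') (m := m) (by omega) (by omega)]
    split_ifs <;> omega
  · rw [if_neg (by omega)]
    simp only [toCells_of_ge (r := r) (m := m) (by omega) (by omega),
      toCells_of_ge (r := r') (m := m) (by omega) (by omega)]
    split_ifs <;> omega
  · rw [if_neg (by omega)]
    simp only [toCells_of_ge (r := r) (m := m) (by omega) (by omega),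
      toCells_last (r := r') (m := m) (by omega) hm2]
    split_ifs <;> omega
  · rw [if_pos (by omega)]
    simp only [toCells_last (r := r) (m := m) (by omega) hm2,
      toCells_of_lt (r := r') (m := m) (by omega) hm2]
    split_ifs <;> omega

theorem ofCells_mul_toCells (hm1 : 1 < m) (hm2 : m < n - 1) :
    ofCells n m * toCells n m = 1 := by
  ext ⟨i, hi⟩ ⟨l, hl⟩
  have hi' := Finset.mem_Ico.1 hi
  have hl' := Finset.mem_Ico.1 hl
  rw [Matrix.mul_apply]
  rcases lt_trichotomy l m with h | h | h
  · rw [sum_mul_two_deltas _ _ ⟨m - 1, by omega⟩ ⟨m - 1 - l, by omega⟩ 1]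
    · simp only [ofCells, of_apply, one_apply, Subtype.ext_iff]
      split_ifs <;> omega
    · intro j
      simp only [toCells, of_apply, Fin.ext_iff]
      split_ifs <;> omega
  · rw [sum_mul_two_deltas _ _ ⟨m - 1, by omega⟩ ⟨n - 1, by omega⟩ 1]
    · simp only [ofCells, of_apply, one_apply, Subtype.ext_iff]
      split_ifs <;> omega
    · intro j
      simp only [toCells, of_apply, Fin.ext_iff]
      split_ifs <;> omega
  · rw [sum_mul_two_deltas _ _ ⟨n - 1, by omega⟩ ⟨l - 1, by omega⟩ 1]
    · simp only [ofCells, of_apply, one_apply, Subtype.ext_iff]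
      split_ifs <;> omega
    · intro j
      simp only [toCells, of_apply, Fin.ext_iff]
      split_ifs <;> omega

theorem toCells_mul_ofCells (hm1 : 1 < m) (hm2 : m < n - 1) :
    toCells n m * ofCells n m =
      1 - vecMulVec (Pi.single ⟨n - 1, by omega⟩ 1) (kernelVec n m) := by
  ext p q
  have hp := p.2
  have hq := q.2
  have hm : m ∈ Finset.Ico 1 n := by simp; omega
  have key : ∀ (a : Cell n) (c d : ℤ), (∀ j, ofCells n m j q =
      (if j = a then c else 0) + (if j = ⟨m, hm⟩ then d else 0)) →
      (toCells n m * ofCells n m) p q = toCells n m p a * c + toCells n m p ⟨m, hm⟩ * d := by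
    intro a c d h
    simp [h, Matrix.mul_apply, mul_add, Finset.sum_add_distrib]
  rcases lt_trichotomy ((q : ℕ) + 1) m with h | h | h
  · rw [key ⟨m - 1 - q, by simp; omega⟩ 1 (-1)]
    · simp only [toCells, of_apply, Matrix.sub_apply, one_apply, vecMulVec_apply, kernelVec,
        Pi.single_apply, Fin.ext_iff]
      split_ifs <;> omega
    · intro j
      have hj := Finset.mem_Ico.1 j.2
      simp only [ofCells, of_apply, Subtype.ext_iff]
      split_ifs <;> omega
  · rw [key ⟨m, hm⟩ 0 1]
    · simp only [toCells, of_apply, Matrix.sub_apply, one_apply, vecMulVec_apply, kernelVec,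
        Pi.single_apply, Fin.ext_iff]
      split_ifs <;> omega
    · intro j
      have hj := Finset.mem_Ico.1 j.2
      simp only [ofCells, of_apply, Subtype.ext_iff]
      split_ifs <;> omega
  · by_cases h' : (q : ℕ) + 1 = n
    · rw [key ⟨m, hm⟩ 0 0]
      · simp only [Matrix.sub_apply, one_apply, vecMulVec_apply, kernelVec,
          Pi.single_apply, Fin.ext_iff]
        split_ifs <;> omega
      · intro j
        have hj := Finset.mem_Ico.1 j.2
        simp only [ofCells, of_apply, Subtype.ext_iff]
        split_ifs <;> omega
    · rw [key ⟨q + 1, by simp; omega⟩ 1 0]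
      · simp only [toCells, of_apply, Matrix.sub_apply, one_apply, vecMulVec_apply, kernelVec,
          Pi.single_apply, Fin.ext_iff]
        split_ifs <;> omega
      · intro j
        have hj := Finset.mem_Ico.1 j.2
        simp only [ofCells, of_apply, Subtype.ext_iff]
        split_ifs <;> omega

theorem kernelVec_vecMul_cycleMatrix (hm1 : 1 < m) (hm2 : m < n - 1) :
    kernelVec n m ᵥ* cycleMatrix n m = kernelVec n m := by
  ext q
  obtain ⟨q', hq'⟩ := exists_cyclic_pred (by omega) q
  have := mul_cycleMatrix_apply hm1 (of fun _ : Unit => kernelVec n m) () q q' hq'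
  change (kernelVec n m ᵥ* cycleMatrix n m) q = _ at this
  rw [this]
  have := q.2
  simp only [kernelVec, of_apply]
  split_ifs <;> omega

theorem trace_transferMatrix_pow (hm1 : 1 < m) (hm2 : m < n - 1) (k : ℕ) :
    trace (transferMatrix n m ^ k) = trace (cycleMatrix n m ^ k) - 1 := by
  have hconj : ∀ k : ℕ, toCells n m * transferMatrix n m ^ k =
      cycleMatrix n m ^ k * toCells n m := by
    intro k
    induction k with
    | zero => simp
    | succ k ih =>
      rw [pow_succ, ← Matrix.mul_assoc, ih, Matrix.mul_assoc, toCells_mul_transferMatrix hm1 hm2,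
        ← Matrix.mul_assoc, pow_succ]
  have hker : ∀ k : ℕ, kernelVec n m ᵥ* cycleMatrix n m ^ k = kernelVec n m := by
    intro k
    induction k with
    | zero => simp
    | succ k ih => rw [pow_succ, ← vecMul_vecMul, ih, kernelVec_vecMul_cycleMatrix hm1 hm2]
  calc trace (transferMatrix n m ^ k)
      = trace (ofCells n m * (toCells n m * transferMatrix n m ^ k)) := by
        rw [← Matrix.mul_assoc, ofCells_mul_toCells hm1 hm2, Matrix.one_mul]
    _ = trace (cycleMatrix n m ^ k * (toCells n m * ofCells n m)) := by
        rw [hconj, Matrix.trace_mul_comm, Matrix.mul_assoc]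
    _ = trace (cycleMatrix n m ^ k) - 1 := by
        rw [toCells_mul_ofCells hm1 hm2, Matrix.mul_sub, Matrix.mul_one, trace_sub,
          Matrix.trace_mul_comm, vecMulVec_mul, hker, trace_vecMulVec, single_dotProduct]
        have : n - 1 + 1 = n := by omega
        simp [kernelVec, this]

theorem cycleMatrix_pow_apply (hm1 : 1 < m) (k : ℕ) (hk : k < n) (r q : Fin n) :
    (q = r → (cycleMatrix n m ^ k) r q = (if (r : ℕ) + 1 = m ∨ (r : ℕ) + 1 = n then 2 else 0) ^ k) ∧
    ((r + k < (q : ℕ) ∨ ((q : ℕ) < r ∧ r + k < (q : ℕ) + n)) → (cycleMatrix n m ^ k) r q = 0) := by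
  induction k generalizing q with
  | zero =>
    refine ⟨fun h => by simp [h], fun h => ?_⟩
    rw [pow_zero, one_apply_ne]
    rintro rfl
    omega
  | succ k ih =>
    obtain ⟨q', hq'⟩ := exists_cyclic_pred (by omega) q
    have h1 := ih (by omega) q
    have h2 := ih (by omega) q'
    have := r.2
    rw [pow_succ, mul_cycleMatrix_apply hm1 _ r q q' hq']
    constructor
    · rintro rfl
      rw [h1.1 rfl, h2.2 (by omega), pow_succ, zero_add]
    · intro h
      rw [h1.2 (by omega), h2.2 (by omega)]
      simp

theorem trace_cycleMatrix_pow_of_lt (hm1 : 1 < m) (hm2 : m < n - 1) (k : ℕ) (hk0 : 0 < k)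
    (hk : k < n) : trace (cycleMatrix n m ^ k) = 2 ^ (k + 1) := by
  have h : ∀ r : Fin n, (cycleMatrix n m ^ k) r r =
      (if r = ⟨m - 1, by omega⟩ then 2 ^ k else 0) + if r = ⟨n - 1, by omega⟩ then 2 ^ k else 0 := by
    intro r
    rw [(cycleMatrix_pow_apply hm1 k hk r r).1 rfl]
    simp only [Fin.ext_iff]
    have : (0 : ℤ) ^ k = 0 := zero_pow (by omega)
    split_ifs <;> omega
  simp only [trace, diag_apply, h, Finset.sum_add_distrib, Finset.sum_ite_eq', Finset.mem_univ,
    if_true]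
  ring

theorem cycleMatrix_annihilated (hm1 : 1 < m) (hm2 : m < n - 1) :
    cycleMatrix n m ^ (n - 2) * (cycleMatrix n m - 2) ^ 2 = 1 := by
  set B := cycleMatrix n m with hB
  have hstep : ∀ r r' : Fin n, ((r : ℕ) + 1 = r' ∨ ((r : ℕ) + 1 = n ∧ (r' : ℕ) = 0)) →
      B.row r = Pi.single r' 1 +
        if (r : ℕ) + 1 = m ∨ (r : ℕ) + 1 = n then (2 : ℤ) • Pi.single r 1 else 0 := by
    intro r r' h
    have := r.2
    ext q
    simp only [hB, row, cycleMatrix, of_apply, Pi.add_apply, Pi.single_apply, Fin.ext_iff]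
    split_ifs <;> simp [Pi.single_apply, Fin.ext_iff] <;> omega
  have hrun : ∀ j s : ℕ, ∀ (h : s + j < n), (s + j < m ∨ m ≤ s ∧ s + j < n) →
      Pi.single (⟨s, by omega⟩ : Fin n) 1 ᵥ* B ^ j = Pi.single (⟨s + j, h⟩ : Fin n) (1 : ℤ) := by
    intro j
    induction j with
    | zero => intro s h _; simp
    | succ j ih =>
      intro s h h'
      rw [pow_succ, ← vecMul_vecMul, ih s (by omega) (by omega), single_one_vecMul,
        hstep ⟨s + j, by omega⟩ ⟨s + (j + 1), h⟩ (by simp; omega), if_neg (by simp; omega), add_zero]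
  have hturn : ∀ r r' : Fin n, ((r : ℕ) + 1 = r' ∨ ((r : ℕ) + 1 = n ∧ (r' : ℕ) = 0)) →
      ((r : ℕ) + 1 = m ∨ (r : ℕ) + 1 = n) →
      Pi.single r 1 ᵥ* (B - 2) = Pi.single r' (1 : ℤ) := by
    intro r r' h h'
    rw [vecMul_sub, single_one_vecMul, hstep r r' h, if_pos h',
      show (2 : Matrix (Fin n) (Fin n) ℤ) = (2 : ℤ) • 1 by
        ext i j
        simp [Matrix.ofNat_apply, Matrix.one_apply],
      vecMul_smul, vecMul_one]
    simp
  have hzero : Pi.single (⟨0, by omega⟩ : Fin n) 1 ᵥ* (B ^ (n - 2) * (B - 2) ^ 2) =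
      Pi.single (⟨0, by omega⟩ : Fin n) (1 : ℤ) := by
    have hc : Commute (B - 2) (B ^ (n - 1 - m)) :=
      ((Commute.refl B).sub_left (Commute.ofNat_left 2 B)).pow_right _
    have hfac : B ^ (n - 2) * (B - 2) ^ 2 =
        B ^ (m - 1) * ((B - 2) * (B ^ (n - 1 - m) * (B - 2))) := by
      rw [← mul_assoc (B - 2), hc.eq, show n - 2 = m - 1 + (n - 1 - m) by omega, pow_add, sq]
      simp only [mul_assoc]
    rw [hfac, ← vecMul_vecMul, hrun (m - 1) 0 (by omega) (by omega), ← vecMul_vecMul,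
      hturn _ ⟨m, by omega⟩ (by simp; omega) (by simp; omega), ← vecMul_vecMul,
      hrun (n - 1 - m) m (by omega) (by omega),
      hturn _ ⟨0, by omega⟩ (by simp; omega) (by simp; omega)]
  have hcomm : Commute B (B ^ (n - 2) * (B - 2) ^ 2) :=
    (Commute.pow_right (Commute.refl B) _).mul_right
      (((Commute.refl B).sub_right (Commute.ofNat_right B 2)).pow_right _)
  have hrow : ∀ s : ℕ, ∀ h : s < n, Pi.single (⟨s, h⟩ : Fin n) 1 ᵥ* (B ^ (n - 2) * (B - 2) ^ 2) =
      Pi.single (⟨s, h⟩ : Fin n) (1 : ℤ) := by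
    intro s
    induction s with
    | zero => intro h; exact hzero
    | succ s ih =>
      intro h
      have e : Pi.single (⟨s + 1, h⟩ : Fin n) (1 : ℤ) =
          Pi.single (⟨s, by omega⟩ : Fin n) 1 ᵥ* B -
          if s + 1 = m ∨ s + 1 = n then (2 : ℤ) • Pi.single (⟨s, by omega⟩ : Fin n) 1 else 0 := by
        rw [single_one_vecMul, hstep ⟨s, by omega⟩ ⟨s + 1, h⟩ (Or.inl rfl), add_sub_cancel_right]
      rw [e, sub_vecMul, vecMul_vecMul, hcomm.eq, ← vecMul_vecMul, ih (by omega)]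
      split_ifs
      · rw [smul_vecMul, ih (by omega)]
      · rw [zero_vecMul]
  ext i j
  have := congrFun (hrow i i.2) j
  rw [single_one_vecMul] at this
  simpa [row, Pi.single_apply, one_apply, eq_comm] using this

theorem trace_cycleMatrix_pow_recurrence (hm1 : 1 < m) (hm2 : m < n - 1) (k : ℕ) (hk : n ≤ k) :
    trace (cycleMatrix n m ^ k) = 4 * trace (cycleMatrix n m ^ (k - 1)) -
      4 * trace (cycleMatrix n m ^ (k - 2)) + trace (cycleMatrix n m ^ (k - n)) := by
  obtain ⟨d, rfl⟩ := Nat.exists_eq_add_of_le hk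
  set B := cycleMatrix n m with hB
  have h : B ^ (n + d) = (4 : ℤ) • B ^ (n + d - 1) - (4 : ℤ) • B ^ (n + d - 2) + B ^ (n + d - n) := by
    have h1 := cycleMatrix_annihilated hm1 hm2
    rw [← hB] at h1
    rw [show n + d - n = d by omega, ← one_mul (B ^ d), ← h1, show n + d - 1 = (n - 2) + 1 + d by omega,
      show n + d - 2 = (n - 2) + d by omega]
    nth_rw 1 [show n + d = (n - 2) + 2 + d by omega]
    simp only [pow_add, pow_two, pow_one]
    noncomm_ring
  rw [h, trace_add, trace_sub, trace_smul, trace_smul]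
  simp

/-- `f` agrees with the piecewise affine map `f_{m,n}` on `[1,n]`. -/
structure IsCycleMap (n m : ℕ) (f : ℝ → ℝ) : Prop where
  one_lt : 1 < m
  lt_sub_one : m < n - 1
  left : ∀ x, 1 ≤ x → x ≤ 2 → f x = m + 1 - m * (x - 1)
  down : ∀ x : ℝ, 2 ≤ x → x ≤ m → f x = x - 1
  mid : ∀ x, (m : ℝ) ≤ x → x ≤ m + 1 → f x = m - 1 + 3 * (x - m)
  up : ∀ x, (m : ℝ) + 1 ≤ x → x ≤ n - 1 → f x = x + 1
  right : ∀ x, (n : ℝ) - 1 ≤ x → x ≤ n → f x = n - (n - m) * (x - (n - 1))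

/-- The cells `[i,i+1)` for `i < m`, `[m,m+1]`, and `(i,i+1]` for `i > m` partition `[1,n]`. -/
def InCell (m i : ℕ) (x : ℝ) : Prop :=
  (i : ℝ) ≤ x ∧ x ≤ i + 1 ∧ (i < m → x < i + 1) ∧ (m < i → (i : ℝ) < x)

variable {f : ℝ → ℝ}

theorem inCell_natCast {i p : ℕ} : InCell m i p ↔
    i ≤ p ∧ p ≤ i + 1 ∧ (i < m → p < i + 1) ∧ (m < i → i < p) := by
  simp only [InCell]
  norm_cast

theorem InCell.unique {i j : ℕ} {x : ℝ} (hi : InCell m i x) (hj : InCell m j x) : i = j := by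
  obtain ⟨a1, a2, a3, a4⟩ := hi
  obtain ⟨b1, b2, b3, b4⟩ := hj
  rcases lt_trichotomy i j with h | h | h
  · exfalso
    have h' : (i : ℝ) + 1 ≤ j := by exact_mod_cast h
    by_cases hm : i < m
    · linarith [a3 hm]
    · linarith [b4 (by omega)]
  · exact h
  · exfalso
    have h' : (j : ℝ) + 1 ≤ i := by exact_mod_cast h
    by_cases hm : j < m
    · linarith [b3 hm]
    · linarith [a4 (by omega)]

theorem exists_inCell (hm1 : 1 < m) (hm2 : m < n - 1) {x : ℝ} (h1 : 1 ≤ x) (hn : x ≤ n) :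
    ∃ i : Cell n, InCell m i x := by
  rcases lt_trichotomy x (m + 1) with h | h | h
  · have h2 : ⌊x⌋₊ < m + 1 := by
      rw [Nat.floor_lt (by linarith)]
      exact_mod_cast h
    have h3 : 1 ≤ ⌊x⌋₊ := by rwa [Nat.one_le_floor_iff]
    refine ⟨⟨⌊x⌋₊, Finset.mem_Ico.2 ⟨h3, by omega⟩⟩, Nat.floor_le (by linarith), (Nat.lt_floor_add_one x).le,
      fun _ => Nat.lt_floor_add_one x, fun h => ?_⟩
    simp only at h
    omega
  · refine ⟨⟨m, by simp; omega⟩, ?_, h.le, fun h => ?_, fun h => ?_⟩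
    · simp only
      linarith
    · simp at h
    · simp at h
  · have h2 : m + 1 < ⌈x⌉₊ := by
      rw [Nat.lt_ceil]
      exact_mod_cast h
    have h3 : ⌈x⌉₊ ≤ n := Nat.ceil_le.2 hn
    have h4 := Nat.ceil_lt_add_one (show 0 ≤ x by linarith)
    have h5 := Nat.le_ceil x
    have h6 : ((⌈x⌉₊ - 1 : ℕ) : ℝ) = ⌈x⌉₊ - 1 := by
      rw [Nat.cast_sub (by omega)]
      simp
    refine ⟨⟨⌈x⌉₊ - 1, by simp; omega⟩, ?_, ?_, fun h => ?_, fun h => ?_⟩ <;>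
      simp only [h6] at * <;> first | linarith | omega

theorem IsCycleMap.edge (hf : IsCycleMap n m f) {i j : Cell n} {x : ℝ} (hi : InCell m i x)
    (hj : InCell m j (f x)) : Edge n m i j := by
  obtain ⟨i, hi0⟩ := i
  obtain ⟨j, hj0⟩ := j
  have hm1 := hf.one_lt
  have hm2 := hf.lt_sub_one
  have hi' := Finset.mem_Ico.1 hi0
  simp only at hi hj ⊢
  have hmr : (1 : ℝ) < m := by exact_mod_cast hm1
  have hnm : (m : ℝ) + 1 < n := by exact_mod_cast (show m + 1 < n by omega)
  obtain ⟨a1, a2, a3, a4⟩ := hi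
  obtain h | h | h | h | h : i = 1 ∨ (1 < i ∧ i < m) ∨ i = m ∨ (m < i ∧ i + 1 < n) ∨ i + 1 = n := by
    omega
  · refine Or.inl ⟨h, ?_⟩
    subst h
    by_contra! hc
    have hc' : (m : ℝ) + 1 ≤ j := by exact_mod_cast hc
    have b4 := hj.2.2.2 hc
    push_cast at *
    rw [hf.left x a1 (by linarith)] at b4
    nlinarith
  · refine Or.inr (Or.inl ⟨h.1, h.2, ?_⟩)
    have h2 : (2 : ℝ) ≤ i := by exact_mod_cast h.1
    have h3 : (i : ℝ) + 1 ≤ m := by exact_mod_cast h.2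
    rw [hf.down x (by linarith) (by linarith)] at hj
    have := a3 h.2
    have hc : ((i - 1 : ℕ) : ℝ) = i - 1 := by rw [Nat.cast_sub (by omega)]; simp
    have : j = i - 1 := hj.unique ⟨by rw [hc]; linarith, by rw [hc]; linarith,
      fun _ => by rw [hc]; linarith, fun h' => by omega⟩
    omega
  · refine Or.inr (Or.inr (Or.inl ⟨h, ?_⟩))
    subst h
    rw [hf.mid x a1 a2] at hj
    obtain ⟨b1, b2, b3, b4⟩ := hj
    constructor
    · by_contra! hc
      have := b3 (by omega)
      have hc' : (j : ℝ) + 2 ≤ i := by exact_mod_cast hc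
      linarith
    · by_contra! hc
      have := b4 (by omega)
      have hc' : (i : ℝ) + 2 ≤ j := by exact_mod_cast hc
      linarith
  · refine Or.inr (Or.inr (Or.inr (Or.inl ⟨h.1, h.2, ?_⟩)))
    have h2 : (m : ℝ) + 1 ≤ i := by exact_mod_cast h.1
    have h3 : (i : ℝ) + 2 ≤ n := by exact_mod_cast h.2
    rw [hf.up x (by linarith) (by linarith)] at hj
    have := a4 h.1
    exact hj.unique ⟨by push_cast; linarith, by push_cast; linarith, fun h' => by omega,
      fun _ => by push_cast; linarith⟩
  · refine Or.inr (Or.inr (Or.inr (Or.inr ⟨h, ?_⟩)))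
    by_contra! hc
    have b3 := hj.2.2.1 hc
    have h2 : (i : ℝ) + 1 = n := by exact_mod_cast h
    have hc' : (j : ℝ) + 1 ≤ m := by exact_mod_cast hc
    rw [hf.right x (by linarith) (by linarith)] at b3
    nlinarith

theorem IsCycleMap.exists_inverse_branch (hf : IsCycleMap n m f) {i j : ℕ} (hj1 : 1 ≤ j) (hjn : j < n)
    (h : Edge n m i j) :
    ∃ g : ℝ → ℝ, Continuous g ∧ ∀ y ∈ Set.Icc (j : ℝ) (j + 1),
      g y ∈ Set.Icc (i : ℝ) (i + 1) ∧ f (g y) = y := by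
  have hm1 := hf.one_lt
  have hm2 := hf.lt_sub_one
  have hmr : (1 : ℝ) < m := by exact_mod_cast hm1
  have hnm : (m : ℝ) + 1 < n := by exact_mod_cast (show m + 1 < n by omega)
  have hj1' : (1 : ℝ) ≤ j := by exact_mod_cast hj1
  have hjn' : (j : ℝ) + 1 ≤ n := by exact_mod_cast hjn
  rcases h with ⟨rfl, h⟩ | ⟨h1, h2, rfl⟩ | ⟨rfl, h1, h2⟩ | ⟨h1, h2, rfl⟩ | ⟨h1, h2⟩
  · have h' : (j : ℝ) ≤ m := by exact_mod_cast h
    refine ⟨fun y => 1 + (m + 1 - y) / m, by fun_prop, fun y hy => ?_⟩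
    have e1 : 0 ≤ (m + 1 - y) / m := div_nonneg (by linarith [hy.2]) (by linarith)
    have e2 : (m + 1 - y) / m ≤ 1 := by
      rw [div_le_one (by linarith)]
      linarith [hy.1]
    refine ⟨⟨by push_cast; linarith, by push_cast; linarith⟩, ?_⟩
    rw [hf.left _ (by linarith) (by linarith)]
    field_simp
    ring
  · have h2' : (j : ℝ) + 2 ≤ m := by exact_mod_cast h2
    refine ⟨fun y => y + 1, by fun_prop, fun y hy => ?_⟩
    have := hy.1
    have := hy.2
    refine ⟨⟨by push_cast; linarith, by push_cast; linarith⟩, ?_⟩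
    rw [hf.down _ (by linarith) (by linarith)]
    ring
  · have h1' : (i : ℝ) ≤ j + 1 := by exact_mod_cast h1
    have h2' : (j : ℝ) ≤ i + 1 := by exact_mod_cast h2
    refine ⟨fun y => i + (y - (i - 1)) / 3, by fun_prop, fun y hy => ?_⟩
    have := hy.1
    have := hy.2
    refine ⟨⟨by linarith, by linarith⟩, ?_⟩
    rw [hf.mid _ (by linarith) (by linarith)]
    ring
  · have h1' : (m : ℝ) + 1 ≤ i := by exact_mod_cast h1
    have h2' : (i : ℝ) + 2 ≤ n := by exact_mod_cast h2
    refine ⟨fun y => y - 1, by fun_prop, fun y hy => ?_⟩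
    have := hy.1
    have := hy.2
    push_cast at *
    refine ⟨⟨by linarith, by linarith⟩, ?_⟩
    rw [hf.up _ (by linarith) (by linarith)]
    ring
  · have h' : (m : ℝ) ≤ j := by exact_mod_cast h2
    have h1' : (i : ℝ) + 1 = n := by exact_mod_cast h1
    have hpos : (0 : ℝ) < n - m := by linarith
    refine ⟨fun y => n - 1 + (n - y) / (n - m), by fun_prop, fun y hy => ?_⟩
    have e1 : 0 ≤ (n - y) / (n - m : ℝ) := div_nonneg (by linarith [hy.2]) (by linarith)
    have e2 : (n - y) / (n - m : ℝ) ≤ 1 := by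
      rw [div_le_one (by linarith)]
      linarith [hy.1]
    refine ⟨⟨by linarith, by linarith⟩, ?_⟩
    rw [hf.right _ (by linarith) (by linarith)]
    field_simp
    ring

theorem IsCycleMap.expanding (hf : IsCycleMap n m f) {i : ℕ} (hi1 : 1 ≤ i) (hin : i < n) {x y : ℝ}
    (hx : x ∈ Set.Icc (i : ℝ) (i + 1)) (hy : y ∈ Set.Icc (i : ℝ) (i + 1)) :
    |x - y| ≤ |f x - f y| ∧
      ((i = 1 ∨ i = m ∨ i + 1 = n) → 2 * |x - y| ≤ |f x - f y|) := by
  have hm1 := hf.one_lt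
  have hm2 := hf.lt_sub_one
  have hmr : (2 : ℝ) ≤ m := by exact_mod_cast hm1
  have hnm : (m : ℝ) + 2 ≤ n := by exact_mod_cast (show m + 2 ≤ n by omega)
  obtain ⟨hx1, hx2⟩ := hx
  obtain ⟨hy1, hy2⟩ := hy
  have key : ∀ s : ℝ, 2 ≤ |s| → f x - f y = s * (x - y) → |x - y| ≤ |f x - f y| ∧
      ((i = 1 ∨ i = m ∨ i + 1 = n) → 2 * |x - y| ≤ |f x - f y|) := by
    intro s hs h
    rw [h, abs_mul]
    have := mul_le_mul_of_nonneg_right hs (abs_nonneg (x - y))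
    exact ⟨by linarith [abs_nonneg (x - y)], fun _ => this⟩
  obtain h | h | h | h | h : i = 1 ∨ (1 < i ∧ i < m) ∨ i = m ∨ (m < i ∧ i + 1 < n) ∨ i + 1 = n := by
    omega
  · subst h
    push_cast at *
    refine key (-m) (by rw [abs_neg, abs_of_nonneg] <;> linarith) ?_
    rw [hf.left x hx1 (by linarith), hf.left y hy1 (by linarith)]
    ring
  · have h1 : (2 : ℝ) ≤ i := by exact_mod_cast h.1
    have h2 : (i : ℝ) + 1 ≤ m := by exact_mod_cast h.2
    rw [hf.down x (by linarith) (by linarith), hf.down y (by linarith) (by linarith),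
      sub_sub_sub_cancel_right]
    exact ⟨le_rfl, fun h' => by omega⟩
  · subst h
    refine key 3 (by norm_num) ?_
    rw [hf.mid x hx1 hx2, hf.mid y hy1 hy2]
    ring
  · have h1 : (m : ℝ) + 1 ≤ i := by exact_mod_cast h.1
    have h2 : (i : ℝ) + 2 ≤ n := by exact_mod_cast h.2
    rw [hf.up x (by linarith) (by linarith), hf.up y (by linarith) (by linarith),
      add_sub_add_right_eq_sub]
    exact ⟨le_rfl, fun h' => by omega⟩
  · have h1 : (i : ℝ) + 1 = n := by exact_mod_cast h
    refine key (-(n - m)) (by rw [abs_neg, abs_of_nonneg] <;> linarith) ?_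
    rw [hf.right x (by linarith) (by linarith), hf.right y (by linarith) (by linarith)]
    ring

theorem IsCycleMap.map_natCast (hf : IsCycleMap n m f) {p : ℕ} (h1 : 1 ≤ p) (hn : p ≤ n) :
    ∃ q : ℕ, f p = q ∧ ((p = 1 ∧ q = m + 1) ∨ (2 ≤ p ∧ p ≤ m ∧ q + 1 = p) ∨
      (m + 1 ≤ p ∧ p < n ∧ q = p + 1) ∨ (p = n ∧ q = m)) := by
  have hm1 := hf.one_lt
  have hm2 := hf.lt_sub_one
  obtain h | h | h | h : p = 1 ∨ (2 ≤ p ∧ p ≤ m) ∨ (m + 1 ≤ p ∧ p < n) ∨ p = n := by omega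
  · refine ⟨m + 1, ?_, Or.inl ⟨h, rfl⟩⟩
    rw [h, hf.left _ (by norm_num) (by norm_num)]
    push_cast
    ring
  · refine ⟨p - 1, ?_, Or.inr (Or.inl ⟨h.1, h.2, by omega⟩)⟩
    rw [hf.down _ (by exact_mod_cast h.1) (by exact_mod_cast h.2), Nat.cast_sub h1, Nat.cast_one]
  · refine ⟨p + 1, ?_, Or.inr (Or.inr (Or.inl ⟨h.1, h.2, rfl⟩))⟩
    have h2 : (p : ℝ) + 1 ≤ n := by exact_mod_cast h.2
    rw [hf.up _ (by exact_mod_cast h.1) (by linarith)]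
    push_cast
    ring
  · refine ⟨m, ?_, Or.inr (Or.inr (Or.inr ⟨h, rfl⟩))⟩
    rw [h, hf.right _ (by linarith) le_rfl]
    ring

/-- `w` is a walk of length `k` in the transition graph. -/
def IsWalk (n m k : ℕ) (w : ℕ → ℕ) : Prop :=
  (∀ t ≤ k, 1 ≤ w t ∧ w t < n) ∧ ∀ t < k, Edge n m (w t) (w (t + 1))

/-- The orbit of `x` stays in the closed intervals listed by `w` up to time `k`. -/
def Follows (f : ℝ → ℝ) (k : ℕ) (w : ℕ → ℕ) (x : ℝ) : Prop :=
  ∀ t ≤ k, f^[t] x ∈ Set.Icc (w t : ℝ) (w t + 1)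

theorem IsCycleMap.exists_inverse_of_walk (hf : IsCycleMap n m f) {k : ℕ} {w : ℕ → ℕ}
    (hw : IsWalk n m k w) : ∃ g : ℝ → ℝ, Continuous g ∧
      ∀ y ∈ Set.Icc (w k : ℝ) (w k + 1), Follows f k w (g y) ∧ f^[k] (g y) = y := by
  induction k generalizing w with
  | zero =>
    refine ⟨id, continuous_id, fun y hy => ⟨fun t ht => ?_, rfl⟩⟩
    obtain rfl : t = 0 := by omega
    exact hy
  | succ k ih =>
    obtain ⟨g, hg, hgy⟩ := ih (w := fun t => w (t + 1))
      ⟨fun t ht => hw.1 (t + 1) (by omega), fun t ht => hw.2 (t + 1) (by omega)⟩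
    obtain ⟨b, hb, hby⟩ := hf.exists_inverse_branch (hw.1 1 (by omega)).1 (hw.1 1 (by omega)).2
      (hw.2 0 (by omega))
    refine ⟨b ∘ g, hb.comp hg, fun y hy => ?_⟩
    obtain ⟨h1, h2⟩ := hgy y hy
    obtain ⟨h3, h4⟩ := hby (g y) (h1 0 (by omega))
    refine ⟨fun t ht => ?_, by simp only [Function.comp, Function.iterate_succ_apply, h4, h2]⟩
    cases t with
    | zero => exact h3
    | succ t =>
      simp only [Function.comp, Function.iterate_succ_apply, h4]
      exact h1 t (by omega)

theorem IsCycleMap.exists_fixed_point_of_closed_walk (hf : IsCycleMap n m f) {k : ℕ} {w : ℕ → ℕ}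
    (hw : IsWalk n m k w) (hc : w k = w 0) : ∃ x, f^[k] x = x ∧ Follows f k w x := by
  obtain ⟨g, hg, hgy⟩ := hf.exists_inverse_of_walk hw
  obtain ⟨x, hx, hfix⟩ := exists_mem_Icc_isFixedPt_of_mapsTo (f := g)
    (a := (w k : ℝ)) (b := w k + 1) hg.continuousOn (by linarith)
    (fun y hy => by
      have := (hgy y hy).1 0 (Nat.zero_le _)
      rwa [← hc] at this)
  obtain ⟨h1, h2⟩ := hgy x hx
  rw [hfix.eq] at h1 h2
  exact ⟨x, h2, h1⟩

theorem IsCycleMap.fixed_point_unique (hf : IsCycleMap n m f) {k : ℕ} (hk : 0 < k) {w : ℕ → ℕ}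
    (hw : IsWalk n m k w) (hc : w k = w 0) {x y : ℝ} (hx : f^[k] x = x) (hy : f^[k] y = y)
    (hxw : Follows f k w x) (hyw : Follows f k w y) : x = y := by
  by_contra hne
  have hpos : 0 < |x - y| := abs_pos.2 (sub_ne_zero.2 hne)
  set d : ℕ → ℝ := fun t => |f^[t] x - f^[t] y| with hd
  have hexp : ∀ t < k, d t ≤ d (t + 1) ∧
      ((w t = 1 ∨ w t = m ∨ w t + 1 = n) → 2 * d t ≤ d (t + 1)) := by
    intro t ht
    have := hf.expanding (hw.1 t ht.le).1 (hw.1 t ht.le).2 (hxw t ht.le) (hyw t ht.le)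
    simpa only [hd, Function.iterate_succ_apply'] using this
  have hmono : ∀ t ≤ k, d 0 ≤ d t := by
    intro t
    induction t with
    | zero => intro _; exact le_rfl
    | succ t ih => intro ht; exact (ih (by omega)).trans (hexp t (by omega)).1
  have hmono' : ∀ j t, t + j = k → d t ≤ d k := by
    intro j
    induction j with
    | zero => intro t ht; rw [← ht, add_zero]
    | succ j ih => intro t ht; exact (hexp t (by omega)).1.trans (ih (t + 1) (by omega))
  have h0 : d 0 = |x - y| := rfl
  have hdk : d k = |x - y| := by simp only [hd, hx, hy]
  have hnot : ∀ t < k, ¬ (w t = 1 ∨ w t = m ∨ w t + 1 = n) := by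
    intro t ht h
    have h1 := (hexp t ht).2 h
    have h2 := hmono t ht.le
    have h3 := hmono' (k - (t + 1)) (t + 1) (by omega)
    linarith
  rcases lt_or_ge (w 0) m with hlt | hge
  · have : ∀ t ≤ k, w t + t = w 0 := by
      intro t
      induction t with
      | zero => intro _; rfl
      | succ t ih =>
        intro ht
        have h1 := ih (by omega)
        have h2 := hnot t (by omega)
        have h3 := hw.2 t (by omega)
        unfold Edge at h3
        omega
    have := this k le_rfl
    omega
  · have : ∀ t ≤ k, w t = w 0 + t := by
      intro t
      induction t with
      | zero => intro _; rfl
      | succ t ih =>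
        intro ht
        have h1 := ih (by omega)
        have h2 := hnot t (by omega)
        have h3 := hw.2 t (by omega)
        unfold Edge at h3
        omega
    have := this k le_rfl
    omega

theorem IsCycleMap.inCell_of_follows (hf : IsCycleMap n m f) {k : ℕ} (hk : 0 < k) {w : ℕ → ℕ}
    (hw : IsWalk n m k w) (hc : w k = w 0) {x : ℝ} (hx : f^[k] x = x) (hxw : Follows f k w x) :
    ∀ t ≤ k, InCell m (w t) (f^[t] x) := by
  have hm1 := hf.one_lt
  have hm2 := hf.lt_sub_one
  by_contra! hcon
  obtain ⟨t₀, ht₀, hbad⟩ := hcon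
  have hint0 : ∃ p : ℕ, f^[t₀] x = p := by
    obtain ⟨h1, h2⟩ := hxw t₀ ht₀
    by_contra! hp
    refine hbad ⟨h1, h2, fun _ => lt_of_le_of_ne h2 ?_, fun _ => lt_of_le_of_ne h1 ?_⟩
    · exact_mod_cast hp (w t₀ + 1)
    · exact (hp (w t₀)).symm
  have hstep : ∀ t < k, ∀ p : ℕ, f^[t] x = p → ∃ q : ℕ, f^[t + 1] x = q ∧
      ((p = 1 ∧ q = m + 1) ∨ (2 ≤ p ∧ p ≤ m ∧ q + 1 = p) ∨
      (m + 1 ≤ p ∧ p < n ∧ q = p + 1) ∨ (p = n ∧ q = m)) := by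
    intro t ht p hp
    have h1 := hxw t ht.le
    have h2 := hw.1 t ht.le
    rw [hp] at h1
    have h3 : w t ≤ p := by exact_mod_cast h1.1
    have h4 : p ≤ w t + 1 := by exact_mod_cast h1.2
    obtain ⟨q, hq, h⟩ := hf.map_natCast (p := p) (by omega) (by omega)
    exact ⟨q, by rw [Function.iterate_succ_apply', hp, hq], h⟩
  have hintk : ∀ j, t₀ + j ≤ k → ∃ p : ℕ, f^[t₀ + j] x = p := by
    intro j
    induction j with
    | zero => intro _; exact hint0
    | succ j ih =>
      intro hj
      obtain ⟨p, hp⟩ := ih (by omega)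
      obtain ⟨q, hq, _⟩ := hstep _ (by omega) p hp
      exact ⟨q, hq⟩
  have hint : ∀ t ≤ k, ∃ p : ℕ, f^[t] x = p := by
    intro t
    induction t with
    | zero =>
      intro _
      obtain ⟨p, hp⟩ := hintk (k - t₀) (by omega)
      rw [Nat.add_sub_cancel' ht₀, hx] at hp
      exact ⟨p, hp⟩
    | succ t ih =>
      intro ht
      obtain ⟨p, hp⟩ := ih (by omega)
      obtain ⟨q, hq, _⟩ := hstep _ (by omega) p hp
      exact ⟨q, hq⟩
  have hmem : ∀ t ≤ k, ∀ p : ℕ, f^[t] x = p → w t ≤ p ∧ p ≤ w t + 1 := by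
    intro t ht p hp
    have h1 := hxw t ht
    rw [hp] at h1
    exact ⟨by exact_mod_cast h1.1, by exact_mod_cast h1.2⟩
  have hgood : ∀ t < k, InCell m (w t) (f^[t] x) → InCell m (w (t + 1)) (f^[t + 1] x) := by
    intro t ht h
    obtain ⟨p, hp⟩ := hint t ht.le
    obtain ⟨q, hq, hpq⟩ := hstep t ht p hp
    have h1 := hmem t ht.le p hp
    have h2 := hmem (t + 1) ht q hq
    have h3 := hw.2 t ht
    have h4 := hw.1 t ht.le
    have h5 := hw.1 (t + 1) ht
    rw [hp, inCell_natCast] at h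
    rw [hq, inCell_natCast]
    unfold Edge at h3
    omega
  have hall : ∀ s t, s ≤ t → t ≤ k → InCell m (w s) (f^[s] x) → InCell m (w t) (f^[t] x) := by
    intro s t hst
    induction t, hst using Nat.le_induction with
    | base => intro _ h; exact h
    | succ t hst ih => intro ht h; exact hgood t (by omega) (ih (by omega) h)
  have hbad0 : ¬ InCell m (w 0) (f^[0] x) := fun h => hbad (hall 0 t₀ (Nat.zero_le _) ht₀ h)
  have hbadk : ¬ InCell m (w k) (f^[k] x) := by
    rw [hc, hx]
    exact hbad0
  have hbads : ∀ t ≤ k, ¬ InCell m (w t) (f^[t] x) := fun t ht h => hbadk (hall t k ht le_rfl h)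
  obtain ⟨p₀, hp₀⟩ := hint 0 (Nat.zero_le _)
  have hpk : f^[k] x = p₀ := hx.trans hp₀
  have hb₀ := hbads 0 (Nat.zero_le _)
  rw [hp₀, inCell_natCast] at hb₀
  have hm₀ := hmem 0 (Nat.zero_le _) p₀ hp₀
  rcases lt_or_ge (w 0) m with hlt | hge
  · have : ∀ t ≤ k, ∃ p : ℕ, f^[t] x = p ∧ p + t = p₀ ∧ w t + 1 = p ∧ p ≤ m := by
      intro t
      induction t with
      | zero => intro _; exact ⟨p₀, hp₀, by omega⟩
      | succ t ih =>
        intro ht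
        obtain ⟨p, hp, h⟩ := ih (by omega)
        obtain ⟨q, hq, hpq⟩ := hstep t (by omega) p hp
        have h1 := hbads (t + 1) ht
        rw [hq, inCell_natCast] at h1
        have h2 := hmem (t + 1) ht q hq
        have h3 := hw.1 t (by omega)
        have h4 := hw.1 (t + 1) ht
        exact ⟨q, hq, by omega⟩
    obtain ⟨p, hp, h⟩ := this k le_rfl
    have : p = p₀ := by exact_mod_cast hp.symm.trans hpk
    omega
  · have : ∀ t ≤ k, ∃ p : ℕ, f^[t] x = p ∧ p = p₀ + t ∧ w t = p ∧ m < p := by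
      intro t
      induction t with
      | zero => intro _; exact ⟨p₀, hp₀, by omega⟩
      | succ t ih =>
        intro ht
        obtain ⟨p, hp, h⟩ := ih (by omega)
        obtain ⟨q, hq, hpq⟩ := hstep t (by omega) p hp
        have h1 := hbads (t + 1) ht
        rw [hq, inCell_natCast] at h1
        have h2 := hmem (t + 1) ht q hq
        have h3 := hw.1 t (by omega)
        exact ⟨q, hq, by omega⟩
    obtain ⟨p, hp, h⟩ := this k le_rfl
    have : p = p₀ := by exact_mod_cast hp.symm.trans hpk
    omega

theorem IsCycleMap.finite_and_ncard_fixed_points (hf : IsCycleMap n m f)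
    (hmaps : Set.MapsTo f (Set.Icc (1 : ℝ) n) (Set.Icc (1 : ℝ) n)) {k : ℕ} (hk : 0 < k) :
    {x ∈ Set.Icc (1 : ℝ) n | f^[k] x = x}.Finite ∧
      {x ∈ Set.Icc (1 : ℝ) n | f^[k] x = x}.ncard =
      {w : Fin (k + 1) → Cell n | w 0 = w (Fin.last k) ∧
        ∀ t : Fin k, Edge n m (w t.castSucc) (w t.succ)}.ncard := by
  set S := {w : Fin (k + 1) → Cell n | w 0 = w (Fin.last k) ∧
        ∀ t : Fin k, Edge n m (w t.castSucc) (w t.succ)} with hS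
  obtain ⟨ext, hext⟩ : ∃ ext : (Fin (k + 1) → Cell n) → ℕ → ℕ,
      ∀ w, ∀ t (ht : t < k + 1), ext w t = w ⟨t, ht⟩ :=
    ⟨fun w t => w (Fin.ofNat (k + 1) t), fun w t ht => by
      simp only [Fin.ofNat, Nat.mod_eq_of_lt ht]⟩
  have hwalk : ∀ w ∈ S, IsWalk n m k (ext w) := by
    rintro w ⟨-, hw⟩
    refine ⟨fun t ht => ?_, fun t ht => ?_⟩
    · rw [hext w t (by omega)]
      exact Finset.mem_Ico.1 (w _).2
    · rw [hext w t (by omega), hext w (t + 1) (by omega)]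
      exact hw ⟨t, ht⟩
  have hclosed : ∀ w ∈ S, ext w k = ext w 0 := by
    rintro w ⟨hw, -⟩
    rw [hext w k (by omega), hext w 0 (by omega)]
    exact congrArg Subtype.val hw.symm
  choose! g hgfix hgfol using fun w (hw : w ∈ S) =>
    hf.exists_fixed_point_of_closed_walk (hwalk w hw) (hclosed w hw)
  have hcell : ∀ w ∈ S, ∀ t : Fin (k + 1), InCell m (w t) (f^[t] (g w)) := by
    intro w hw t
    have := hf.inCell_of_follows hk (hwalk w hw) (hclosed w hw) (hgfix w hw) (hgfol w hw) t
      (by omega)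
    rwa [hext w t t.2] at this
  have hinj : Set.InjOn g S := by
    intro w hw v hv h
    funext t
    have h1 := hcell w hw t
    rw [h] at h1
    exact Subtype.ext (h1.unique (hcell v hv t))
  have himage : {x ∈ Set.Icc (1 : ℝ) n | f^[k] x = x} = g '' S := by
    ext x
    constructor
    · rintro ⟨hx, hfix⟩
      have horb : ∀ t, ∃ i : Cell n, InCell m i (f^[t] x) := fun t =>
        exists_inCell hf.one_lt hf.lt_sub_one ((hmaps.iterate t) hx).1 ((hmaps.iterate t) hx).2
      choose c hc using horb
      have hw : (fun t : Fin (k + 1) => c t) ∈ S := by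
        refine ⟨Subtype.ext ?_, fun t => hf.edge (hc t) ?_⟩
        · have h1 := hc k
          rw [hfix] at h1
          exact (hc 0).unique h1
        · have h1 := hc (t + 1)
          rw [Function.iterate_succ_apply'] at h1
          exact h1
      refine ⟨_, hw, hf.fixed_point_unique hk (hwalk _ hw) (hclosed _ hw) (hgfix _ hw) hfix
        (hgfol _ hw) fun t ht => ?_⟩
      rw [hext _ t (by omega)]
      exact ⟨(hc t).1, (hc t).2.1⟩
    · rintro ⟨w, hw, rfl⟩
      refine ⟨?_, hgfix w hw⟩
      have h1 := hgfol w hw 0 (Nat.zero_le _)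
      have h2 := (hwalk w hw).1 0 (Nat.zero_le _)
      have h3 : (1 : ℝ) ≤ ext w 0 := by exact_mod_cast h2.1
      have h4 : (ext w 0 : ℝ) + 1 ≤ n := by exact_mod_cast h2.2
      exact ⟨h3.trans h1.1, h1.2.trans h4⟩
  rw [himage]
  exact ⟨S.toFinite.image g, hinj.ncard_image⟩

end Counting

/-- For integers `n ≥ 4`, `1 < m < n - 1`, the continuous map `f_{m,n} : [1,n] → [1,n]`
has exactly `a_{n,k}` fixed points of its `k`-th iterate, independently of `m`. -/
theorem statement5 (n m : ℕ) (hn : 4 ≤ n) (hm1 : 1 < m) (hm2 : m < n - 1)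
    (f : ℝ → ℝ)
    (hmaps : Set.MapsTo f (Set.Icc (1 : ℝ) (n : ℝ)) (Set.Icc (1 : ℝ) (n : ℝ)))
    (hcont : ContinuousOn f (Set.Icc (1 : ℝ) (n : ℝ)))
    (hf1 : f 1 = (m : ℝ) + 1) (hf2 : f 2 = 1) (hfm : f (m : ℝ) = (m : ℝ) - 1)
    (hfm1 : f ((m : ℝ) + 1) = (m : ℝ) + 2) (hfn1 : f ((n : ℝ) - 1) = (n : ℝ))
    (hfn : f (n : ℝ) = (m : ℝ))
    (haff1 : AffOn f 1 2) (haff2 : AffOn f 2 (m : ℝ))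
    (haff3 : AffOn f (m : ℝ) ((m : ℝ) + 1))
    (haff4 : AffOn f ((m : ℝ) + 1) ((n : ℝ) - 1))
    (haff5 : AffOn f ((n : ℝ) - 1) (n : ℝ))
    (a : ℕ → ℤ)
    (haLow : ∀ k : ℕ, 1 ≤ k → k ≤ n - 1 → a k = 2 ^ (k + 1) - 1)
    (haRec : ∀ k : ℕ, n ≤ k →
      a k = 3 * a (k - 1) - ∑ i ∈ Finset.Icc 2 (n - 1), a (k - i))
    (k : ℕ) (hk : 0 < k) :
    {x ∈ Set.Icc (1 : ℝ) (n : ℝ) | f^[k] x = x}.Finite ∧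
      ({x ∈ Set.Icc (1 : ℝ) (n : ℝ) | f^[k] x = x}.ncard : ℤ) = a k := by
  have hmr : (1 : ℝ) < m := by exact_mod_cast hm1
  have hnm : (m : ℝ) + 1 < n := by exact_mod_cast (show m + 1 < n by omega)
  have hf : IsCycleMap n m f := by
    refine ⟨hm1, hm2, fun x h1 h2 => ?_, fun x h1 h2 => ?_, fun x h1 h2 => ?_, fun x h1 h2 => ?_,
      fun x h1 h2 => ?_⟩
    · rw [haff1 x ⟨h1, h2⟩, hf1, hf2]
      ring
    · rcases h1.eq_or_lt with rfl | h
      · rw [hf2]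
        norm_num
      · have : (m : ℝ) - 2 ≠ 0 := by linarith
        rw [haff2 x ⟨h1, h2⟩, hf2, hfm]
        field_simp
        ring
    · rw [haff3 x ⟨h1, h2⟩, hfm, hfm1]
      ring
    · rcases h2.eq_or_lt with rfl | h
      · rw [hfn1]
        ring
      · have : (n : ℝ) - 1 - (m + 1) ≠ 0 := by linarith
        rw [haff4 x ⟨h1, h2⟩, hfm1, hfn1]
        field_simp
        ring
    · rw [haff5 x ⟨h1, h2⟩, hfn1, hfn]
      ring
  obtain ⟨hfin, hcard⟩ := hf.finite_and_ncard_fixed_points hmaps hk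
  refine ⟨hfin, ?_⟩
  rw [hcard, eq_sub_one_of_recurrences hn (b := fun k => trace (cycleMatrix n m ^ k)) (by simp)
    (fun k h0 h => trace_cycleMatrix_pow_of_lt hm1 hm2 k h0 h)
    (fun k h => trace_cycleMatrix_pow_recurrence hm1 hm2 k h) haLow haRec k hk,
    ← trace_transferMatrix_pow hm1 hm2, transferMatrix,
    trace_pow_eq_card_closed_walks (fun i j : Cell n => Edge n m i j)]
end

section
/- For every integer n ≥ 3 and every positive integer k, Φ₁(k, φ_{a_n}) ≡ 0 (mod k), where φ_{a_n}(k) = a_{n,k}. -/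
open scoped Classical

/-- `Phi1 m φ = ∑_{d ∣ m, d squarefree} μ(d) · φ(m/d)`. -/
noncomputable def Phi1 (m : ℕ) (φ : ℕ → ℤ) : ℤ :=
  ∑ d ∈ m.divisors.filter (fun d => Squarefree d),
    (ArithmeticFunction.moebius d) * φ (m / d)

open PowerSeries in
/-- The integer power series of the form `X * P' / P`, where `P` has constant coefficient `1`. -/
noncomputable def logDerivSubgroup : AddSubgroup (PowerSeries ℤ) where
  carrier := {A | ∃ P : PowerSeries ℤ, constantCoeff P = 1 ∧ X * d⁄dX ℤ P = P * A}
  zero_mem' := ⟨1, by simp, by simp [Derivation.map_one_eq_zero]⟩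
  add_mem' := by
    rintro A B ⟨P, hP, hA⟩ ⟨Q, hQ, hB⟩
    refine ⟨P * Q, by simp [hP, hQ], ?_⟩
    rw [Derivation.leibniz]
    simp only [smul_eq_mul]
    linear_combination Q * hA + P * hB
  neg_mem' := by
    rintro A ⟨P, hP, hA⟩
    have hinv : P * invOfUnit P 1 = 1 := mul_invOfUnit P 1 (by simp [hP])
    refine ⟨invOfUnit P 1, by simp, ?_⟩
    set Q := invOfUnit P 1
    have hd := congrArg (d⁄dX ℤ) hinv
    rw [Derivation.leibniz, Derivation.map_one_eq_zero] at hd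
    simp only [smul_eq_mul] at hd
    linear_combination (-X * d⁄dX ℤ Q - Q * A) * hinv + X * Q * hd - Q ^ 2 * hA

open PowerSeries in
theorem dvd_coeff_of_mem_logDerivSubgroup {A : PowerSeries ℤ} (hA : A ∈ logDerivSubgroup)
    {N : ℕ} (h : ∀ k < N, coeff k A = 0) : (N : ℤ) ∣ coeff N A := by
  obtain ⟨P, hP, hPA⟩ := hA
  have hcoeff := congrArg (coeff N) hPA
  rw [coeff_mul N P A, Finset.sum_eq_single (0, N)] at hcoeff
  · rw [coeff_zero_eq_constantCoeff_apply, hP, one_mul] at hcoeff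
    rw [← hcoeff]
    cases N with
    | zero => simp
    | succ m =>
      rw [coeff_succ_X_mul, coeff_derivative]
      exact ⟨coeff (m + 1) P, by push_cast; ring⟩
  · rintro ⟨i, j⟩ hij hne
    rw [Finset.HasAntidiagonal.mem_antidiagonal] at hij
    rw [h j, mul_zero]
    simp only [ne_eq, Prod.mk.injEq, not_and] at hne hij
    omega
  · simp

open PowerSeries in
theorem mk_ite_dvd_mem_logDerivSubgroup {m : ℕ} (hm : 0 < m) :
    (mk fun k => if 0 < k ∧ m ∣ k then (m : ℤ) else 0) ∈ logDerivSubgroup := by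
  rw [← neg_mem_iff]
  refine ⟨1 - X ^ m, by simp [hm.ne'], ?_⟩
  ext k
  rw [sub_mul, one_mul, map_sub (coeff k), coeff_X_pow_mul']
  rcases k with _ | k
  · simp [hm.ne']
  · rw [coeff_succ_X_mul, coeff_derivative, map_sub, coeff_X_pow, coeff_one]
    simp only [map_neg, coeff_mk]
    rcases lt_trichotomy m (k + 1) with h | h | h
    · have hd : m ∣ k + 1 - m ↔ m ∣ k + 1 := (Nat.dvd_sub_iff_left h.le dvd_rfl)
      simp [h.le, h.ne', hd, h]
    · subst h
      simp
    · have hd : ¬ m ∣ k + 1 := fun hd => absurd (Nat.le_of_dvd (by omega) hd) (by omega)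
      simp [h.ne, hd, h.not_ge]

theorem sum_divisors_Phi1 (a : ℕ → ℤ) {k : ℕ} (hk : 0 < k) :
    ∑ d ∈ k.divisors, Phi1 d a = a k := by
  refine (ArithmeticFunction.sum_eq_iff_sum_mul_moebius_eq (f := fun d => Phi1 d a)
    (g := a)).2 (fun m _ => ?_) k hk
  rw [Phi1, Finset.sum_filter_of_ne]
  · exact Nat.sum_divisorsAntidiagonal (fun i j => ArithmeticFunction.moebius i * a j)
  · intro d _ hd
    by_contra hs
    exact hd (by rw [ArithmeticFunction.moebius_eq_zero_of_not_squarefree hs, zero_mul])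

open PowerSeries in
/-- The Gauss congruences hold for the coefficients of a logarithmic derivative. -/
theorem dvd_Phi1_of_mem_logDerivSubgroup {a : ℕ → ℤ}
    (ha : (mk fun k => if k = 0 then 0 else a k) ∈ logDerivSubgroup) (k : ℕ) :
    (k : ℤ) ∣ Phi1 k a := by
  induction k using Nat.strong_induction_on with
  | _ N ih =>
  rcases N.eq_zero_or_pos with rfl | hN
  · simp [Phi1]
  set S : PowerSeries ℤ := ∑ d ∈ Finset.Ico 1 N,
    (Phi1 d a / d) • (mk fun k => if 0 < k ∧ d ∣ k then (d : ℤ) else 0) with hS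
  have hSmem : S ∈ logDerivSubgroup := sum_mem fun d hd =>
    zsmul_mem (mk_ite_dvd_mem_logDerivSubgroup (by simp at hd; omega)) _
  have hcoeff (k : ℕ) (hk : 0 < k) :
      coeff k S = ∑ d ∈ Finset.Ico 1 N with d ∣ k, Phi1 d a := by
    rw [hS, map_sum, Finset.sum_filter]
    refine Finset.sum_congr rfl fun d hd => ?_
    rw [map_zsmul, coeff_mk, smul_eq_mul]
    by_cases hdk : d ∣ k
    · simp only [hk, hdk, and_self, if_true]
      exact Int.ediv_mul_cancel (ih d (Finset.mem_Ico.1 hd).2)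
    · simp [hdk]
  have key := dvd_coeff_of_mem_logDerivSubgroup (N := N) (sub_mem ha hSmem) ?_
  · rw [map_sub, coeff_mk, if_neg hN.ne', hcoeff N hN, ← sum_divisors_Phi1 a hN,
      ← Nat.cons_self_properDivisors hN.ne', Finset.sum_cons] at key
    rwa [Nat.properDivisors, add_sub_cancel_right] at key
  · intro k hk
    rcases k.eq_zero_or_pos with rfl | hk0
    · simp [hS]
    · rw [map_sub, coeff_mk, if_neg hk0.ne', hcoeff k hk0, ← sum_divisors_Phi1 a hk0, sub_eq_zero]
      refine Finset.sum_congr ?_ fun _ _ => rfl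
      ext d
      simp only [Nat.mem_divisors, Finset.mem_filter, Finset.mem_Ico]
      refine ⟨fun h => ⟨⟨Nat.pos_of_dvd_of_pos h.1 hk0, (Nat.le_of_dvd hk0 h.1).trans_lt hk⟩, h.1⟩,
        fun h => ⟨h.2, hk0.ne'⟩⟩

theorem sum_range_two_pow_sub_one (k : ℕ) :
    ∑ i ∈ Finset.range k, ((2 : ℤ) ^ (k - i + 1) - 1) = 2 ^ (k + 2) - 4 - k := by
  induction k with
  | zero => simp
  | succ k ih =>
    rw [Finset.sum_range_succ']
    simp only [Nat.add_sub_add_right, ih]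
    push_cast
    ring

open PowerSeries in
theorem mk_mem_logDerivSubgroup_of_recurrence {n : ℕ} (hn : 3 ≤ n) {a : ℕ → ℤ}
    (haLow : ∀ k : ℕ, 1 ≤ k → k ≤ n - 1 → a k = 2 ^ (k + 1) - 1)
    (haRec : ∀ k : ℕ, n ≤ k →
      a k = 3 * a (k - 1) - ∑ i ∈ Finset.Icc 2 (n - 1), a (k - i)) :
    (mk fun k => if k = 0 then 0 else a k) ∈ logDerivSubgroup := by
  rw [← neg_mem_iff]
  refine ⟨1 - 3 * X + ∑ i ∈ Finset.Ico 2 n, X ^ i, ?_, ?_⟩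
  · simp only [map_add, map_sub, map_mul, map_one, constantCoeff_X, mul_zero, map_sum, map_pow]
    rw [Finset.sum_eq_zero]
    · simp
    · intro i hi
      simp only [Finset.mem_Ico] at hi
      exact zero_pow (by omega)
  have h3 : (3 : PowerSeries ℤ) = C 3 := by simp
  ext k
  rw [add_mul, sub_mul, one_mul, Finset.sum_mul, map_add (coeff k), map_sub (coeff k),
    map_sum (coeff k), mul_assoc, h3, coeff_C_mul]
  rcases k with _ | k
  · simp
  rw [coeff_succ_X_mul, coeff_succ_X_mul, coeff_derivative]
  simp only [coeff_X_pow_mul', map_neg, coeff_mk, map_add, map_sub, map_sum, coeff_X_pow,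
    coeff_C_mul, coeff_X, coeff_one]
  rcases k with _ | k
  · rw [Finset.sum_eq_zero, Finset.sum_eq_zero, haLow 1 le_rfl (by omega)]
    · simp
    · intro i hi
      simp only [Finset.mem_Ico] at hi
      rw [if_neg (by omega)]
    · intro i hi
      simp only [Finset.mem_Ico] at hi
      rw [if_neg (by omega)]
  rw [Finset.sum_ite_eq]
  simp only [Finset.mem_Ico]
  rcases lt_or_ge (k + 2) n with h | h
  · have hs : ∑ i ∈ Finset.Ico 2 n, (if i ≤ k + 1 + 1 then
        -(if k + 1 + 1 - i = 0 then 0 else a (k + 1 + 1 - i)) else 0) = -(2 ^ (k + 2) - 4 - k) := by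
      rw [← sum_range_two_pow_sub_one, ← Finset.sum_neg_distrib, Finset.sum_Ico_eq_sum_range]
      symm
      refine (Finset.sum_congr rfl fun i hi => ?_).trans
        (Finset.sum_subset (Finset.range_subset_range.2 (by omega : k ≤ n - 2)) ?_)
      · simp only [Finset.mem_range] at hi
        rw [if_pos (by omega), if_neg (by omega), show k + 1 + 1 - (2 + i) = k - i by omega,
          haLow (k - i) (by omega) (by omega)]
      · intro i hi hi'
        simp only [Finset.mem_range] at hi hi'
        split_ifs <;> omega
    rw [hs, if_pos (⟨by omega, h⟩ : 2 ≤ k + 1 + 1 ∧ k + 1 + 1 < n),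
      haLow (k + 1 + 1) (by omega) (by omega), haLow (k + 1) (by omega) (by omega)]
    simp
    ring
  · have hs : ∑ i ∈ Finset.Ico 2 n, (if i ≤ k + 1 + 1 then
        -(if k + 1 + 1 - i = 0 then 0 else a (k + 1 + 1 - i)) else 0) =
        -∑ i ∈ Finset.Icc 2 (n - 1), a (k + 1 + 1 - i) := by
      rw [← Finset.sum_neg_distrib]
      refine Finset.sum_congr (by ext; simp only [Finset.mem_Ico, Finset.mem_Icc]; omega) ?_
      intro i hi
      simp only [Finset.mem_Icc] at hi
      rw [if_pos (by omega), if_neg (by omega)]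
    rw [hs, if_neg (by omega : ¬ (2 ≤ k + 1 + 1 ∧ k + 1 + 1 < n)), haRec (k + 1 + 1) h]
    simp

/-- For `n ≥ 3` and the sequence `a_{n,k}`, `Φ₁(k, a_n) ≡ 0 (mod k)`. -/
theorem statement6 (n : ℕ) (hn : 3 ≤ n) (a : ℕ → ℤ)
    (haLow : ∀ k : ℕ, 1 ≤ k → k ≤ n - 1 → a k = 2 ^ (k + 1) - 1)
    (haRec : ∀ k : ℕ, n ≤ k →
      a k = 3 * a (k - 1) - ∑ i ∈ Finset.Icc 2 (n - 1), a (k - i))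
    (k : ℕ) (hk : 0 < k) :
    (k : ℤ) ∣ Phi1 k a :=
  dvd_Phi1_of_mem_logDerivSubgroup (mk_mem_logDerivSubgroup_of_recurrence hn haLow haRec) k
end

section
/- For every integer n ≥ 1, let g_n : [1,2n+1] → [1,2n+1] be the continuous map with g_n(1) = n+1, g_n(2) = 2n+1, g_n(n+1) = n+2, g_n(n+2) = n, g_n(2n+1) = 1, and g_n affine on each of the intervals [1,2], [2,n+1], [n+1,n+2], [n+2,2n+1]. Then for every positive integer k, the set {x ∈ [1,2n+1] : g_n^k(x) = x} is finite and has exactly b_{n,k} elements. -/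
namespace StefanMap

/-- Left endpoint of the `u`-th Markov interval, numbered along the chain of coverings. -/
noncomputable def lo (n u : ℕ) : ℝ :=
  if u % 2 = 0 then (n : ℝ) + 2 + (u / 2 : ℕ) else (n : ℝ) + 1 - (u / 2 : ℕ)

/-- The `u`-th closed Markov interval. -/
def box (n u : ℕ) : Set ℝ := Set.Icc (lo n u) (lo n u + 1)

/-- The `u`-th Markov interval without the endpoint that belongs to another cell. -/
def cell (n u : ℕ) : Set ℝ :=
  if u = 0 then Set.Icc (lo n u) (lo n u + 1)
  else if u % 2 = 0 then Set.Ioc (lo n u) (lo n u + 1)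
  else Set.Ico (lo n u) (lo n u + 1)

/-- The affine branch of the map on the `u`-th interval. -/
noncomputable def fwd (n u : ℕ) (x : ℝ) : ℝ :=
  if u = 0 then 3 * (n + 2) + 1 - 2 * x
  else if u = 2 * n + 1 then n + 2 + (x - 1) * (n + 1)
  else if u % 2 = 0 then 2 * (n + 2) - x
  else 2 * (n + 2) + 1 - x

/-- The inverse of the affine branch on the `u`-th interval. -/
noncomputable def bwd (n u : ℕ) (y : ℝ) : ℝ :=
  if u = 0 then (3 * (n + 2) + 1 - y) / 2
  else if u = 2 * n + 1 then 1 + (y - (n + 2)) / (n + 1)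
  else if u % 2 = 0 then 2 * (n + 2) - y
  else 2 * (n + 2) + 1 - y

/-- The slope of `bwd n u`. -/
noncomputable def slope (n u : ℕ) : ℝ :=
  if u = 0 then -1 / 2 else if u = 2 * n + 1 then 1 / (n + 1) else -1

/-- The intervals covered by the `u`-th one. -/
def succs (n u : ℕ) : Finset ℕ :=
  if u = 0 then {0, 1}
  else if u = 2 * n + 1 then (Finset.range (n + 1)).image (2 * ·)
  else {u + 1}

/-- The number of paths of length `k` from `u` to `v` in the Markov graph. -/
def pathCount (n : ℕ) : ℕ → ℕ → ℕ → ℕ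
  | 0, u, v => if u = v then 1 else 0
  | k + 1, u, v => ∑ w ∈ succs n u, pathCount n k w v

/-- A real number that is an integer. -/
def IsInt (x : ℝ) : Prop := ∃ z : ℤ, x = z

lemma index_cases {n u : ℕ} (hu : u < 2 * n + 2) :
    u = 0 ∨ u = 2 * n + 1 ∨ (∃ m < n, u = 2 * m + 2) ∨ ∃ m < n, u = 2 * m + 1 := by
  rcases Nat.even_or_odd' u with ⟨m, rfl | rfl⟩
  · rcases m with _ | m
    · simp
    · exact Or.inr (Or.inr (Or.inl ⟨m, by omega, by ring⟩))
  · rcases Nat.lt_or_ge m n with h | h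
    · exact Or.inr (Or.inr (Or.inr ⟨m, h, rfl⟩))
    · exact Or.inr (Or.inl (by omega))

lemma lo_even (n m : ℕ) : lo n (2 * m) = n + 2 + m := by simp [lo]

lemma lo_odd (n m : ℕ) : lo n (2 * m + 1) = n + 1 - m := by
  have : (2 * m + 1) / 2 = m := by omega
  simp [lo, this, Nat.add_mod]

lemma box_even (n m : ℕ) : box n (2 * m) = Set.Icc ((n : ℝ) + 2 + m) (n + 3 + m) := by
  rw [box, lo_even]; ring_nf

lemma box_odd (n m : ℕ) : box n (2 * m + 1) = Set.Icc ((n : ℝ) + 1 - m) (n + 2 - m) := by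
  rw [box, lo_odd]; ring_nf

lemma cell_zero (n : ℕ) : cell n 0 = Set.Icc ((n : ℝ) + 2) (n + 3) := by
  have h := lo_even n 0
  simp only [mul_zero] at h
  simp only [cell, if_true, h]; norm_num; ring_nf

lemma cell_even (n m : ℕ) :
    cell n (2 * m + 2) = Set.Ioc ((n : ℝ) + 3 + m) (n + 4 + m) := by
  have h : lo n (2 * m + 2) = n + 3 + m := by
    rw [show 2 * m + 2 = 2 * (m + 1) by ring, lo_even]; push_cast; ring
  rw [cell, if_neg (by omega), if_pos (by omega), h]; ring_nf

lemma cell_odd (n m : ℕ) :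
    cell n (2 * m + 1) = Set.Ico ((n : ℝ) + 1 - m) (n + 2 - m) := by
  rw [cell, if_neg (by omega), if_neg (by omega), lo_odd]; ring_nf

lemma box_zero (n : ℕ) : box n 0 = Set.Icc ((n : ℝ) + 2) (n + 3) := by
  simpa using box_even n 0

lemma box_even' (n m : ℕ) : box n (2 * m + 2) = Set.Icc ((n : ℝ) + 3 + m) (n + 4 + m) := by
  rw [show 2 * m + 2 = 2 * (m + 1) by ring, box_even]; push_cast; ring_nf

lemma cell_subset_box (n u : ℕ) : cell n u ⊆ box n u := by
  unfold cell box
  split_ifs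
  exacts [subset_rfl, Set.Ioc_subset_Icc_self, Set.Ico_subset_Icc_self]

lemma IsInt.lo (n u : ℕ) : IsInt (lo n u) := by
  unfold StefanMap.lo
  generalize u / 2 = q
  split_ifs
  · exact ⟨n + 2 + q, by push_cast; ring⟩
  · exact ⟨n + 1 - q, by push_cast; ring⟩

lemma mem_cell_or_isInt {n u : ℕ} {x : ℝ} (hx : x ∈ box n u) : x ∈ cell n u ∨ IsInt x := by
  obtain ⟨z, hz⟩ := IsInt.lo n u
  by_cases h1 : x = lo n u
  · exact Or.inr ⟨z, by rw [h1, hz]⟩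
  by_cases h2 : x = lo n u + 1
  · exact Or.inr ⟨z + 1, by rw [h2, hz]; push_cast; ring⟩
  left
  have h3 := lt_of_le_of_ne hx.1 (Ne.symm h1)
  have h4 := lt_of_le_of_ne hx.2 h2
  unfold cell
  split_ifs
  exacts [hx, ⟨h3, hx.2⟩, ⟨hx.1, h4⟩]

lemma cell_disjoint {n u v : ℕ} {x : ℝ} (hu : x ∈ cell n u) (hv : x ∈ cell n v) : u = v := by
  have key : ∀ w : ℕ, w = 0 ∨ (∃ m, w = 2 * m + 2) ∨ ∃ m, w = 2 * m + 1 := fun w => by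
    rcases Nat.even_or_odd' w with ⟨m, rfl | rfl⟩
    · rcases m with _ | m
      · simp
      · exact Or.inr (Or.inl ⟨m, by ring⟩)
    · exact Or.inr (Or.inr ⟨m, rfl⟩)
  rcases key u with rfl | ⟨a, rfl⟩ | ⟨a, rfl⟩ <;> rcases key v with rfl | ⟨b, rfl⟩ | ⟨b, rfl⟩ <;>
    simp only [cell_zero, cell_even, cell_odd, Set.mem_Icc, Set.mem_Ioc, Set.mem_Ico] at hu hv
  · rfl
  · have : (0 : ℝ) ≤ b := b.cast_nonneg
    linarith
  · have : (0 : ℝ) ≤ b := b.cast_nonneg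
    linarith
  · have : (0 : ℝ) ≤ a := a.cast_nonneg
    linarith
  · have h1 : (a : ℝ) < b + 1 := by linarith
    have h2 : (b : ℝ) < a + 1 := by linarith
    have h1' : a < b + 1 := by exact_mod_cast h1
    have h2' : b < a + 1 := by exact_mod_cast h2
    omega
  · have : (0 : ℝ) ≤ a := a.cast_nonneg
    have : (0 : ℝ) ≤ b := b.cast_nonneg
    linarith
  · have : (0 : ℝ) ≤ a := a.cast_nonneg
    linarith
  · have : (0 : ℝ) ≤ a := a.cast_nonneg
    have : (0 : ℝ) ≤ b := b.cast_nonneg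
    linarith
  · have h1 : (a : ℝ) < b + 1 := by linarith
    have h2 : (b : ℝ) < a + 1 := by linarith
    have h1' : a < b + 1 := by exact_mod_cast h1
    have h2' : b < a + 1 := by exact_mod_cast h2
    omega

lemma exists_cell_of_mem {n : ℕ} {x : ℝ} (hx : x ∈ Set.Icc (1 : ℝ) (2 * n + 3)) :
    ∃ u < 2 * n + 2, x ∈ cell n u := by
  obtain ⟨h1, h2⟩ := hx
  rcases lt_or_ge x (n + 2) with h | h
  · obtain ⟨m, hm⟩ : ∃ m : ℕ, m = ⌈(n : ℝ) + 1 - x⌉₊ := ⟨_, rfl⟩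
    have hm1 : (n : ℝ) + 1 - x ≤ m := hm ▸ Nat.le_ceil _
    have hm2 : (m : ℝ) < n + 2 - x := by
      rcases le_or_gt ((n : ℝ) + 1 - x) 0 with h0 | h0
      · rw [hm, Nat.ceil_eq_zero.2 h0]; push_cast; linarith
      · have := Nat.ceil_lt_add_one h0.le
        rw [← hm] at this; linarith
    have : (m : ℝ) < n + 1 := by linarith
    have : m < n + 1 := by exact_mod_cast this
    exact ⟨2 * m + 1, by omega, by rw [cell_odd]; constructor <;> linarith⟩
  · rcases le_or_gt x (n + 3) with h' | h'
    · exact ⟨0, by omega, by rw [cell_zero]; exact ⟨h, h'⟩⟩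
    · obtain ⟨m, hm⟩ : ∃ m : ℕ, m + 1 = ⌈x - (n + 3)⌉₊ :=
        ⟨_, Nat.sub_add_cancel (Nat.ceil_pos.2 (by linarith))⟩
      have hm1 : x - (n + 3) ≤ (m + 1 : ℕ) := hm ▸ Nat.le_ceil _
      have hm2 := Nat.ceil_lt_add_one (show 0 ≤ x - (n + 3) by linarith)
      rw [← hm] at hm2
      push_cast at hm1 hm2
      have : (m : ℝ) < n := by linarith
      have : m < n := by exact_mod_cast this
      exact ⟨2 * m + 2, by omega, by rw [cell_even]; constructor <;> linarith⟩

section Branches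
variable (n : ℕ) (x : ℝ)

lemma fwd_zero : fwd n 0 x = 3 * (n + 2) + 1 - 2 * x := by simp [fwd]
lemma fwd_last : fwd n (2 * n + 1) x = n + 2 + (x - 1) * (n + 1) := by simp [fwd]
lemma fwd_even {m : ℕ} : fwd n (2 * m + 2) x = 2 * (n + 2) - x := by
  rw [fwd, if_neg (by omega), if_neg (by omega), if_pos (by omega)]
lemma fwd_odd {m : ℕ} (hm : m < n) : fwd n (2 * m + 1) x = 2 * (n + 2) + 1 - x := by
  rw [fwd, if_neg (by omega), if_neg (by omega), if_neg (by omega)]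

lemma bwd_zero : bwd n 0 x = (3 * (n + 2) + 1 - x) / 2 := by simp [bwd]
lemma bwd_last : bwd n (2 * n + 1) x = 1 + (x - (n + 2)) / (n + 1) := by simp [bwd]
lemma bwd_even {m : ℕ} : bwd n (2 * m + 2) x = 2 * (n + 2) - x := by
  rw [bwd, if_neg (by omega), if_neg (by omega), if_pos (by omega)]
lemma bwd_odd {m : ℕ} (hm : m < n) : bwd n (2 * m + 1) x = 2 * (n + 2) + 1 - x := by
  rw [bwd, if_neg (by omega), if_neg (by omega), if_neg (by omega)]

end Branches

lemma bwd_fwd (n u : ℕ) (x : ℝ) : bwd n u (fwd n u x) = x := by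
  have : (n : ℝ) + 1 ≠ 0 := by positivity
  unfold bwd fwd
  split_ifs <;> first | ring1 | (field_simp; ring)

lemma fwd_bwd (n u : ℕ) (x : ℝ) : fwd n u (bwd n u x) = x := by
  have : (n : ℝ) + 1 ≠ 0 := by positivity
  unfold bwd fwd
  split_ifs <;> first | ring1 | (field_simp; ring)

lemma bwd_sub (n u : ℕ) (x y : ℝ) : bwd n u x - bwd n u y = slope n u * (x - y) := by
  unfold bwd slope
  split_ifs <;> ring

lemma IsInt.fwd {x : ℝ} (n u : ℕ) (hx : IsInt x) : IsInt (fwd n u x) := by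
  obtain ⟨z, rfl⟩ := hx
  unfold StefanMap.fwd
  split_ifs
  · exact ⟨3 * (n + 2) + 1 - 2 * z, by push_cast; ring⟩
  · exact ⟨n + 2 + (z - 1) * (n + 1), by push_cast; ring⟩
  · exact ⟨2 * (n + 2) - z, by push_cast; ring⟩
  · exact ⟨2 * (n + 2) + 1 - z, by push_cast; ring⟩

lemma IsInt.of_bwd {n u : ℕ} {y : ℝ} (h : IsInt (bwd n u y)) : IsInt y := by
  simpa [fwd_bwd] using h.fwd n u

lemma succs_zero (n : ℕ) : succs n 0 = {0, 1} := by simp [succs]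
lemma succs_last (n : ℕ) : succs n (2 * n + 1) = (Finset.range (n + 1)).image (2 * ·) := by
  simp [succs]
lemma succs_mid {n u : ℕ} (h0 : u ≠ 0) (h1 : u ≠ 2 * n + 1) : succs n u = {u + 1} := by
  simp [succs, h0, h1]

lemma lt_of_mem_succs {n u w : ℕ} (hu : u < 2 * n + 2) (hw : w ∈ succs n u) : w < 2 * n + 2 := by
  unfold succs at hw
  split_ifs at hw
  · simp at hw; omega
  · simp at hw; omega
  · simp at hw; omega

lemma bwd_mem_box {n u w : ℕ} {y : ℝ} (hu : u < 2 * n + 2) (hw : w ∈ succs n u)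
    (hy : y ∈ box n w) : bwd n u y ∈ box n u := by
  rcases index_cases hu with rfl | rfl | ⟨m, hm, rfl⟩ | ⟨m, hm, rfl⟩
  · rw [succs_zero] at hw
    simp only [Finset.mem_insert, Finset.mem_singleton] at hw
    rw [bwd_zero, box_zero]
    rcases hw with rfl | rfl
    · rw [box_zero] at hy
      constructor <;> linarith [hy.1, hy.2]
    · have := box_odd n 0
      simp only [mul_zero, zero_add, Nat.cast_zero] at this
      rw [this] at hy
      constructor <;> linarith [hy.1, hy.2]
  · rw [succs_last] at hw
    simp only [Finset.mem_image, Finset.mem_range] at hw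
    obtain ⟨l, hl, rfl⟩ := hw
    rw [box_even] at hy
    rw [bwd_last, box_odd]
    have hl' : (l : ℝ) ≤ n := by exact_mod_cast Nat.lt_succ_iff.1 hl
    have hl0 : (0 : ℝ) ≤ l := l.cast_nonneg
    have hn : (0 : ℝ) < n + 1 := by positivity
    have h1 : 0 ≤ (y - (n + 2)) / (n + 1) := div_nonneg (by linarith [hy.1]) hn.le
    have h2 : (y - (n + 2)) / (n + 1) ≤ 1 := (div_le_one hn).2 (by linarith [hy.2])
    constructor <;> linarith
  · rw [succs_mid (by omega) (by omega), Finset.mem_singleton] at hw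
    subst hw
    rw [show 2 * m + 2 + 1 = 2 * (m + 1) + 1 by ring, box_odd] at hy
    push_cast at hy
    rw [bwd_even, box_even']
    constructor <;> linarith [hy.1, hy.2]
  · rw [succs_mid (by omega) (by omega), Finset.mem_singleton] at hw
    subst hw
    rw [show 2 * m + 1 + 1 = 2 * m + 2 by ring, box_even'] at hy
    rw [bwd_odd _ _ hm, box_odd]
    constructor <;> linarith [hy.1, hy.2]

/-- An integer preimage under an expanding branch forces the right choice of cell. -/
lemma mem_cell_of_isInt_bwd {n u w : ℕ} {y : ℝ} (hu : u = 0 ∨ u = 2 * n + 1)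
    (hw : w ∈ succs n u) (hy : y ∈ box n w) (hi : IsInt (bwd n u y)) : y ∈ cell n w := by
  obtain ⟨z, hz⟩ := hi
  rcases hu with rfl | rfl
  · rw [succs_zero] at hw
    simp only [Finset.mem_insert, Finset.mem_singleton] at hw
    rw [bwd_zero] at hz
    rcases hw with rfl | rfl
    · rwa [cell_zero, ← box_zero]
    · have h1 := box_odd n 0
      have h2 := cell_odd n 0
      simp only [mul_zero, zero_add, Nat.cast_zero] at h1 h2
      rw [h1] at hy
      rw [h2]
      refine ⟨hy.1, lt_of_le_of_ne hy.2 fun h => ?_⟩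
      have : (2 * z : ℝ) = 2 * n + 5 := by rw [← hz, h]; ring
      have : 2 * z = 2 * n + 5 := by exact_mod_cast this
      omega
  · rw [succs_last] at hw
    simp only [Finset.mem_image, Finset.mem_range] at hw
    obtain ⟨l, hl, rfl⟩ := hw
    rcases l with _ | l
    · rwa [mul_zero, cell_zero, ← box_zero]
    rw [show 2 * (l + 1) = 2 * l + 2 by ring, box_even'] at hy
    rw [show 2 * (l + 1) = 2 * l + 2 by ring, cell_even]
    refine ⟨lt_of_le_of_ne hy.1 fun h => ?_, hy.2⟩
    rw [bwd_last, ← h] at hz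
    have hn : (n : ℝ) + 1 ≠ 0 := by positivity
    field_simp at hz
    have h3 : (l + 1 : ℝ) = (z - 1) * (n + 1) := by linarith
    have h4 : (l + 1 : ℤ) = (z - 1) * (n + 1) := by exact_mod_cast h3
    have h5 : (l : ℤ) + 1 < n + 1 := by exact_mod_cast hl
    rcases le_or_gt (z - 1) 0 with h0 | h0
    · nlinarith
    · nlinarith

lemma mem_cell_of_bwd_mem {n u w : ℕ} {y : ℝ} (hu : u < 2 * n + 2) (hw : w ∈ succs n u)
    (hy : y ∈ box n w) (hi : IsInt (bwd n u y)) (hc : bwd n u y ∈ cell n u) :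
    y ∈ cell n w := by
  rcases index_cases hu with h | h | ⟨m, hm, rfl⟩ | ⟨m, hm, rfl⟩
  · exact mem_cell_of_isInt_bwd (Or.inl h) hw hy hi
  · exact mem_cell_of_isInt_bwd (Or.inr h) hw hy hi
  · rw [succs_mid (by omega) (by omega), Finset.mem_singleton] at hw
    subst hw
    rw [show 2 * m + 2 + 1 = 2 * (m + 1) + 1 by ring, cell_odd]
    rw [bwd_even, cell_even] at hc
    push_cast
    constructor <;> linarith [hc.1, hc.2]
  · rw [succs_mid (by omega) (by omega), Finset.mem_singleton] at hw
    subst hw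
    rw [show 2 * m + 1 + 1 = 2 * m + 2 by ring, cell_even]
    rw [bwd_odd _ _ hm, cell_odd] at hc
    constructor <;> linarith [hc.1, hc.2]

lemma exists_succ_of_mem_cell {n u : ℕ} {x : ℝ} (hu : u < 2 * n + 2) (hx : x ∈ cell n u) :
    ∃ w ∈ succs n u, fwd n u x ∈ cell n w := by
  rcases index_cases hu with rfl | rfl | ⟨m, hm, rfl⟩ | ⟨m, hm, rfl⟩
  · rw [cell_zero] at hx
    rw [fwd_zero, succs_zero]
    rcases le_or_gt ((n : ℝ) + 2) (3 * (n + 2) + 1 - 2 * x) with h | h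
    · exact ⟨0, by simp, by rw [cell_zero]; constructor <;> linarith [hx.1, hx.2]⟩
    · refine ⟨1, by simp, ?_⟩
      have h2 := cell_odd n 0
      simp only [mul_zero, zero_add, Nat.cast_zero] at h2
      rw [h2]; constructor <;> linarith [hx.1, hx.2]
  · rw [cell_odd] at hx
    have h1 : (0 : ℝ) ≤ (x - 1) * (n + 1) := mul_nonneg (by linarith [hx.1]) (by positivity)
    have h2 : (x - 1) * (n + 1) ≤ n + 1 := by nlinarith [hx.2, (n.cast_nonneg : (0 : ℝ) ≤ n)]
    have h3 : fwd n (2 * n + 1) x ∈ Set.Icc (1 : ℝ) (2 * n + 3) := by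
      rw [fwd_last]
      constructor <;> linarith [(n.cast_nonneg : (0 : ℝ) ≤ n)]
    obtain ⟨w, hw, hc⟩ := exists_cell_of_mem h3
    refine ⟨w, ?_, hc⟩
    rw [succs_last]
    rcases Nat.even_or_odd' w with ⟨l, rfl | rfl⟩
    · exact Finset.mem_image.2 ⟨l, by simp; omega, rfl⟩
    · rw [cell_odd, fwd_last] at hc
      have := hc.2
      have : (0 : ℝ) ≤ l := l.cast_nonneg
      linarith
  · refine ⟨_, by rw [succs_mid (by omega) (by omega)]; exact Finset.mem_singleton_self _, ?_⟩
    rw [show 2 * m + 2 + 1 = 2 * (m + 1) + 1 by ring, cell_odd, fwd_even]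
    rw [cell_even] at hx
    push_cast
    constructor <;> linarith [hx.1, hx.2]
  · refine ⟨_, by rw [succs_mid (by omega) (by omega)]; exact Finset.mem_singleton_self _, ?_⟩
    rw [show 2 * m + 1 + 1 = 2 * m + 2 by ring, cell_even, fwd_odd _ _ hm]
    rw [cell_odd] at hx
    constructor <;> linarith [hx.1, hx.2]

/-- Affine maps `h` from the `u`-th to the `v`-th interval that behave like a composition of
`m` inverse branches along a path from `v` to `u`. -/
structure Admissible (n u v m : ℕ) (h : ℝ → ℝ) (α : ℝ) : Prop where
  affine : ∀ x y, h x - h y = α * (x - y)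
  abs_le : |α| ≤ 1
  maps : ∀ x ∈ box n u, h x ∈ box n v
  isInt : ∀ x ∈ box n u, IsInt (h x) → IsInt x
  good : ∀ x ∈ box n u, IsInt (h x) → h x ∈ cell n v → x ∈ cell n u
  alt : (v + m ≤ u ∧ (v = 0 → u = 0)) ∨
    ((|α| < 1 ∨ (u = 0 ∧ v ≠ 0)) ∧ ∀ x ∈ box n u, IsInt (h x) → x ∈ cell n u)

lemma Admissible.id (n u : ℕ) : Admissible n u u 0 id 1 where
  affine x y := by simp
  abs_le := by simp
  maps x hx := hx
  isInt x _ h := h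
  good x _ _ h := h
  alt := Or.inl (by simp)

lemma abs_slope_le (n u : ℕ) : |slope n u| ≤ 1 := by
  have hn : (1 : ℝ) ≤ n + 1 := by linarith [(n.cast_nonneg : (0 : ℝ) ≤ n)]
  unfold slope
  split_ifs
  · norm_num [abs_div]
  · rw [abs_of_nonneg (by positivity)]
    exact (div_le_one (by linarith)).2 hn
  · simp

lemma abs_slope_zero (n : ℕ) : |slope n 0| < 1 := by
  norm_num [slope, abs_div]

lemma abs_slope_last {n : ℕ} (hn : n ≠ 0) : |slope n (2 * n + 1)| < 1 := by
  have hn : (0 : ℝ) < n := by positivity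
  rw [slope, if_neg (by omega), if_pos rfl, abs_of_nonneg (by positivity)]
  exact (div_lt_one (by linarith)).2 (by linarith)

lemma abs_mul_lt_one_left {a b : ℝ} (ha : |a| < 1) (hb : |b| ≤ 1) : |a * b| < 1 := by
  rw [abs_mul]; nlinarith [abs_nonneg a, abs_nonneg b]

lemma abs_mul_lt_one_right {a b : ℝ} (ha : |a| ≤ 1) (hb : |b| < 1) : |a * b| < 1 := by
  rw [mul_comm]; exact abs_mul_lt_one_left hb ha

lemma Admissible.comp {n u v m w : ℕ} {h : ℝ → ℝ} {α : ℝ} (H : Admissible n u v m h α)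
    (hu : u < 2 * n + 2) (hw : w ∈ succs n u) :
    Admissible n w v (m + 1) (h ∘ bwd n u) (α * slope n u) where
  affine x y := by simp only [Function.comp]; rw [H.affine, bwd_sub]; ring
  abs_le := by
    rw [abs_mul]; exact mul_le_one₀ H.abs_le (abs_nonneg _) (abs_slope_le n u)
  maps x hx := H.maps _ (bwd_mem_box hu hw hx)
  isInt x hx hi := (H.isInt _ (bwd_mem_box hu hw hx) hi).of_bwd
  good x hx hi hc := mem_cell_of_bwd_mem hu hw hx (H.isInt _ (bwd_mem_box hu hw hx) hi)
    (H.good _ (bwd_mem_box hu hw hx) hi hc)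
  alt := by
    by_cases hends : u = 0 ∨ u = 2 * n + 1
    · by_cases hB : |α * slope n u| < 1 ∨ (w = 0 ∧ v ≠ 0)
      · exact Or.inr ⟨hB, fun x hx hi => mem_cell_of_isInt_bwd hends hw hx
          (H.isInt _ (bwd_mem_box hu hw hx) hi)⟩
      · exfalso
        push Not at hB
        obtain ⟨hB1, hB2⟩ := hB
        rcases hends with rfl | rfl
        · exact absurd (abs_mul_lt_one_right H.abs_le (abs_slope_zero n)) (not_lt.2 hB1)
        · rcases eq_or_ne n 0 with rfl | hn
          · have hw0 : w = 0 := by simpa [succs] using hw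
            have hv := hB2 hw0
            rcases H.alt with h | ⟨h | h, -⟩
            · have := h.2 hv
              omega
            · exact absurd (abs_mul_lt_one_left h (abs_slope_le _ _)) (not_lt.2 hB1)
            · omega
          · exact absurd (abs_mul_lt_one_right H.abs_le (abs_slope_last hn)) (not_lt.2 hB1)
    · push Not at hends
      have hw' := hw
      rw [succs_mid hends.1 hends.2, Finset.mem_singleton] at hw'
      rcases H.alt with h | ⟨h1, h2⟩
      · left
        omega
      · right
        refine ⟨?_, fun x hx hi => ?_⟩
        · rcases h1 with h1 | h1
          · exact Or.inl (abs_mul_lt_one_left h1 (abs_slope_le _ _))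
          · omega
        · have hb := bwd_mem_box hu hw hx
          exact mem_cell_of_bwd_mem hu hw hx (H.isInt _ hb hi) (h2 _ hb hi)

lemma Admissible.exists_unique_fixed {n u m : ℕ} {h : ℝ → ℝ} {α : ℝ}
    (H : Admissible n u u m h α) (hm : 0 < m) :
    ∃ p, ∀ x, (x ∈ cell n u ∧ h x = x) ↔ x = p := by
  rcases H.alt with h' | ⟨h1, h2⟩
  · omega
  have hα : |α| < 1 := by
    rcases h1 with h1 | h1
    · exact h1
    · omega
  obtain ⟨hα1, hα2⟩ := abs_lt.1 hα
  have hpos : 0 < 1 - α := by linarith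
  have hform : ∀ x, h x = α * x + h 0 := fun x => by
    have := H.affine x 0
    linarith
  have hp : h (h 0 / (1 - α)) = h 0 / (1 - α) := by
    rw [hform]; field_simp; ring
  have hlo := (H.maps (lo n u) ⟨le_rfl, by linarith⟩).1
  have hhi := (H.maps (lo n u + 1) ⟨by linarith, le_rfl⟩).2
  rw [hform] at hlo hhi
  have hbox : h 0 / (1 - α) ∈ box n u := by
    constructor
    · rw [le_div_iff₀ hpos]; linarith
    · rw [div_le_iff₀ hpos]; linarith
  refine ⟨h 0 / (1 - α), fun x => ⟨fun hx => ?_, ?_⟩⟩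
  · rw [eq_div_iff hpos.ne']
    have := hform x
    linarith [hx.2]
  · rintro rfl
    refine ⟨?_, hp⟩
    rcases mem_cell_or_isInt hbox with hc | hi
    · exact hc
    · exact h2 _ hbox (by rwa [hp])

lemma isInt_iterate {n : ℕ} {g : ℝ → ℝ}
    (hg : ∀ u < 2 * n + 2, ∀ x ∈ box n u, g x = fwd n u x) (k : ℕ) :
    ∀ {u : ℕ} {x : ℝ}, u < 2 * n + 2 → x ∈ cell n u → IsInt x → IsInt (g^[k] x) := by
  induction k with
  | zero => exact fun _ _ h => h
  | succ k ih =>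
    intro u x hu hx hi
    obtain ⟨w, hw, hc⟩ := exists_succ_of_mem_cell hu hx
    rw [Function.iterate_succ_apply, hg u hu x (cell_subset_box n u hx)]
    exact ih (lt_of_mem_succs hu hw) hc (hi.fwd n u)

/-- The orbit segments of length `k` that start in the `u`-th cell, end in the `v`-th cell and
satisfy `h x = g^[k] x` are counted by paths. -/
lemma exists_finset_card_eq_pathCount {n : ℕ} {g : ℝ → ℝ}
    (hg : ∀ u < 2 * n + 2, ∀ x ∈ box n u, g x = fwd n u x) (k : ℕ) :
    ∀ {u v m : ℕ} {h : ℝ → ℝ} {α : ℝ}, u < 2 * n + 2 → v < 2 * n + 2 → 0 < m + k →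
      Admissible n u v m h α →
      ∃ F : Finset ℝ, (∀ x, x ∈ F ↔ x ∈ cell n u ∧ g^[k] x ∈ cell n v ∧ h x = g^[k] x) ∧
        F.card = pathCount n k u v := by
  induction k with
  | zero =>
    intro u v m h α hu hv hm H
    simp only [Function.iterate_zero, id_eq, pathCount]
    split_ifs with huv
    · subst huv
      obtain ⟨p, hp⟩ := H.exists_unique_fixed (by omega)
      refine ⟨{p}, fun x => ?_, by simp⟩
      rw [Finset.mem_singleton, ← hp]
      tauto
    · refine ⟨∅, fun x => ?_, rfl⟩
      simp only [Finset.notMem_empty, false_iff]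
      rintro ⟨h1, h2, -⟩
      exact huv (cell_disjoint h1 h2)
  | succ k ih =>
    intro u v m h α hu hv hm H
    have hF : ∀ w : ℕ, ∃ F : Finset ℝ, w ∈ succs n u →
        (∀ x, x ∈ F ↔ x ∈ cell n w ∧ g^[k] x ∈ cell n v ∧ (h ∘ bwd n u) x = g^[k] x) ∧
        F.card = pathCount n k w v := by
      intro w
      by_cases hw : w ∈ succs n u
      · obtain ⟨F, hF⟩ := ih (lt_of_mem_succs hu hw) hv (by omega) (H.comp hu hw)
        exact ⟨F, fun _ => hF⟩
      · exact ⟨∅, fun h => absurd h hw⟩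
    choose F hF using hF
    have hinj : Function.Injective (bwd n u) :=
      Function.LeftInverse.injective (g := fwd n u) (fwd_bwd n u)
    refine ⟨((succs n u).biUnion F).image (bwd n u), fun x => ?_, ?_⟩
    · simp only [Finset.mem_image, Finset.mem_biUnion]
      constructor
      · rintro ⟨y, ⟨w, hw, hy⟩, rfl⟩
        obtain ⟨h1, h2, h3⟩ := ((hF w hw).1 y).1 hy
        have hwlt := lt_of_mem_succs hu hw
        have hbox := bwd_mem_box hu hw (cell_subset_box n w h1)
        have hgx : g (bwd n u y) = y := by rw [hg u hu _ hbox, fwd_bwd]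
        rw [Function.iterate_succ_apply, hgx]
        refine ⟨?_, h2, h3⟩
        rcases mem_cell_or_isInt hbox with hc | hi
        · exact hc
        · have h3' : h (bwd n u y) = g^[k] y := h3
          refine H.good _ hbox ?_ (by rwa [h3'])
          rw [h3']
          exact isInt_iterate hg k hwlt h1 hi.of_bwd
      · rintro ⟨h1, h2, h3⟩
        have hgx := hg u hu x (cell_subset_box n u h1)
        obtain ⟨w, hw, hc⟩ := exists_succ_of_mem_cell hu h1
        rw [Function.iterate_succ_apply, hgx] at h2 h3
        refine ⟨fwd n u x, ⟨w, hw, ((hF w hw).1 _).2 ⟨hc, h2, ?_⟩⟩, bwd_fwd n u x⟩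
        rwa [Function.comp, bwd_fwd]
    · rw [Finset.card_image_of_injective _ hinj, Finset.card_biUnion, pathCount]
      · exact Finset.sum_congr rfl fun w hw => (hF w hw).2
      · intro a ha b hb hab
        refine Finset.disjoint_left.2 ?_
        intro x hxa hxb
        exact hab (cell_disjoint (((hF a ha).1 x).1 hxa).1 (((hF b hb).1 x).1 hxb).1)

lemma cell_subset_Icc {n u : ℕ} (hu : u < 2 * n + 2) : cell n u ⊆ Set.Icc (1 : ℝ) (2 * n + 3) := by
  intro x hx
  have hx := cell_subset_box n u hx
  rcases Nat.even_or_odd' u with ⟨m, rfl | rfl⟩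
  · have : m ≤ n := by omega
    have : (m : ℝ) ≤ n := by exact_mod_cast this
    have : (0 : ℝ) ≤ m := m.cast_nonneg
    rw [box_even] at hx
    constructor <;> linarith [hx.1, hx.2]
  · have : m ≤ n := by omega
    have : (m : ℝ) ≤ n := by exact_mod_cast this
    have : (0 : ℝ) ≤ m := m.cast_nonneg
    rw [box_odd] at hx
    constructor <;> linarith [hx.1, hx.2]

lemma fixedPoints_iterate_card {n : ℕ} {g : ℝ → ℝ}
    (hg : ∀ u < 2 * n + 2, ∀ x ∈ box n u, g x = fwd n u x) {k : ℕ} (hk : 0 < k) :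
    {x ∈ Set.Icc (1 : ℝ) (2 * n + 3) | g^[k] x = x}.Finite ∧
      {x ∈ Set.Icc (1 : ℝ) (2 * n + 3) | g^[k] x = x}.ncard =
        ∑ u ∈ Finset.range (2 * n + 2), pathCount n k u u := by
  have hF : ∀ u : ℕ, ∃ F : Finset ℝ, u ∈ Finset.range (2 * n + 2) →
      (∀ x, x ∈ F ↔ x ∈ cell n u ∧ g^[k] x ∈ cell n u ∧ x = g^[k] x) ∧
      F.card = pathCount n k u u := by
    intro u
    by_cases hu : u < 2 * n + 2
    · obtain ⟨F, hF⟩ := exists_finset_card_eq_pathCount hg k hu hu (by omega) (Admissible.id n u)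
      exact ⟨F, fun _ => hF⟩
    · exact ⟨∅, fun h => absurd (Finset.mem_range.1 h) hu⟩
  choose F hF using hF
  have hset : {x ∈ Set.Icc (1 : ℝ) (2 * n + 3) | g^[k] x = x} =
      ((Finset.range (2 * n + 2)).biUnion F : Finset ℝ) := by
    ext x
    simp only [Set.mem_ofPred_eq, Finset.mem_coe, Finset.mem_biUnion]
    constructor
    · rintro ⟨hx, hfix⟩
      obtain ⟨u, hu, hc⟩ := exists_cell_of_mem hx
      have hu' := Finset.mem_range.2 hu
      exact ⟨u, hu', ((hF u hu').1 x).2 ⟨hc, by rwa [hfix], hfix.symm⟩⟩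
    · rintro ⟨u, hu, hx⟩
      obtain ⟨h1, -, h3⟩ := ((hF u hu).1 x).1 hx
      exact ⟨cell_subset_Icc (Finset.mem_range.1 hu) h1, h3.symm⟩
  rw [hset]
  refine ⟨Finset.finite_toSet _, ?_⟩
  rw [Set.ncard_coe_finset, Finset.card_biUnion]
  · exact Finset.sum_congr rfl fun u hu => (hF u hu).2
  · intro a ha b hb hab
    refine Finset.disjoint_left.2 fun x hxa hxb => ?_
    exact hab (cell_disjoint (((hF a ha).1 x).1 hxa).1 (((hF b hb).1 x).1 hxb).1)

/-- The trace of the `k`-th power of the transition matrix. -/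
def loopCount (n k : ℕ) : ℤ := ∑ u ∈ Finset.range (2 * n + 2), (pathCount n k u u : ℤ)

lemma pathCount_succ_zero (n k v : ℕ) :
    (pathCount n k 1 v : ℤ) = pathCount n (k + 1) 0 v - pathCount n k 0 v := by
  simp [pathCount, succs_zero]

lemma pathCount_eq_sub {n : ℕ} (k v : ℕ) {u : ℕ} (hu : u ≤ 2 * n) :
    (pathCount n k (u + 1) v : ℤ) =
      pathCount n (k + u + 1) 0 v - pathCount n (k + u) 0 v := by
  induction u generalizing k with
  | zero => simpa using pathCount_succ_zero n k v
  | succ u ih =>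
    have h : pathCount n (k + 1) (u + 1) v = pathCount n k (u + 1 + 1) v := by
      simp [pathCount, succs_mid (show u + 1 ≠ 0 by omega) (show u + 1 ≠ 2 * n + 1 by omega)]
    rw [← h, ih (k + 1) (by omega)]
    ring_nf

lemma pathCount_last (n k v : ℕ) :
    pathCount n (k + 1) (2 * n + 1) v = ∑ l ∈ Finset.range (n + 1), pathCount n k (2 * l) v := by
  simp [pathCount, succs_last, Finset.sum_image]

lemma pathCount_recurrence (n k v : ℕ) :
    (pathCount n (k + 2 * n + 2) 0 v : ℤ) - pathCount n (k + 2 * n + 1) 0 v =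
      pathCount n k 0 v + ∑ l ∈ Finset.range n,
        ((pathCount n (k + 2 * l + 2) 0 v : ℤ) - pathCount n (k + 2 * l + 1) 0 v) := by
  have h1 := pathCount_eq_sub (n := n) (k + 1) v le_rfl
  rw [pathCount_last, Finset.sum_range_succ'] at h1
  push_cast at h1
  rw [show k + 1 + 2 * n + 1 = k + 2 * n + 2 by ring, show k + 1 + 2 * n = k + 2 * n + 1 by ring]
    at h1
  rw [← h1, add_comm]
  refine congrArg₂ _ rfl (Finset.sum_congr rfl fun l hl => ?_)
  have hl := Finset.mem_range.1 hl
  have := pathCount_eq_sub (n := n) k v (u := 2 * l + 1) (by omega)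
  rw [show 2 * (l + 1) = 2 * l + 1 + 1 by ring, this]
  ring_nf

lemma pathCount_zero_recurrence (n k v : ℕ) :
    (pathCount n (k + 2 * n + 3) 0 v : ℤ) =
      2 * pathCount n (k + 2 * n + 1) 0 v + pathCount n k 0 v := by
  have h1 := pathCount_recurrence n k v
  have h2 := pathCount_recurrence n (k + 1) v
  have key : ∀ N : ℕ, ∑ l ∈ Finset.range N,
        ((pathCount n (k + 2 * l + 2) 0 v : ℤ) - pathCount n (k + 2 * l + 1) 0 v) +
      ∑ l ∈ Finset.range N,
        ((pathCount n (k + 1 + 2 * l + 2) 0 v : ℤ) - pathCount n (k + 1 + 2 * l + 1) 0 v) =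
      pathCount n (k + 2 * N + 1) 0 v - pathCount n (k + 1) 0 v := by
    intro N
    induction N with
    | zero => simp
    | succ N ih =>
      rw [Finset.sum_range_succ, Finset.sum_range_succ]
      rw [show k + 1 + 2 * N + 2 = k + 2 * (N + 1) + 1 by ring,
        show k + 1 + 2 * N + 1 = k + 2 * N + 2 by ring]
      linarith
  have h3 := key n
  rw [show k + 1 + 2 * n + 2 = k + 2 * n + 3 by ring,
    show k + 1 + 2 * n + 1 = k + 2 * n + 2 by ring] at h2
  linarith

lemma pathCount_self_recurrence (n k : ℕ) {u v : ℕ} (hu : u < 2 * n + 2) :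
    (pathCount n (k + 2 * n + 3) u v : ℤ) =
      2 * pathCount n (k + 2 * n + 1) u v + pathCount n k u v := by
  rcases u with _ | u
  · exact pathCount_zero_recurrence n k v
  · have hu : u ≤ 2 * n := by omega
    rw [pathCount_eq_sub _ _ hu, pathCount_eq_sub _ _ hu, pathCount_eq_sub _ _ hu]
    have h1 := pathCount_zero_recurrence n (k + u) v
    have h2 := pathCount_zero_recurrence n (k + u + 1) v
    rw [show k + 2 * n + 3 + u = k + u + 2 * n + 3 by ring,
      show k + 2 * n + 1 + u = k + u + 2 * n + 1 by ring]
    rw [show k + u + 1 + 2 * n + 3 = k + u + 2 * n + 3 + 1 by ring,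
      show k + u + 1 + 2 * n + 1 = k + u + 2 * n + 1 + 1 by ring] at h2
    linarith

lemma loopCount_recurrence (n k : ℕ) :
    loopCount n (k + 2 * n + 3) = 2 * loopCount n (k + 2 * n + 1) + loopCount n k := by
  simp only [loopCount, Finset.mul_sum, ← Finset.sum_add_distrib]
  exact Finset.sum_congr rfl fun u hu =>
    pathCount_self_recurrence n k (Finset.mem_range.1 hu)

lemma loopCount_zero (n : ℕ) : loopCount n 0 = 2 * n + 2 := by
  simp [loopCount, pathCount]

/-- For short times, paths from the `0`-th interval just run along the chain. -/
lemma pathCount_zero_of_le {n v : ℕ} (i : ℕ) (hi : i ≤ 2 * n + 1) :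
    (pathCount n i 0 v : ℤ) = if v ≤ i then 1 else 0 := by
  induction i with
  | zero => simp [pathCount, eq_comm]
  | succ i ih =>
    have h := pathCount_eq_sub (n := n) 0 v (u := i) (by omega)
    rw [zero_add, ih (by omega)] at h
    rw [show pathCount n 0 (i + 1) v = if i + 1 = v then 1 else 0 from rfl] at h
    split_ifs at h ⊢ <;> omega

lemma pathCount_turn {n v : ℕ} (hv : v ≤ 2 * n + 1) :
    (pathCount n (2 * n + 2) 0 v : ℤ) = if v % 2 = 0 then 2 else 1 := by
  have h := pathCount_recurrence n 0 v
  rw [zero_add, pathCount_zero_of_le _ le_rfl, pathCount_zero_of_le _ (Nat.zero_le _),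
    if_pos hv] at h
  have hs : ∀ N ≤ n, ((if v ≤ 0 then 1 else 0 : ℤ)) + ∑ l ∈ Finset.range N,
      ((pathCount n (0 + 2 * l + 2) 0 v : ℤ) - pathCount n (0 + 2 * l + 1) 0 v) =
      if v ≤ 2 * N ∧ v % 2 = 0 then 1 else 0 := by
    intro N hN
    induction N with
    | zero => simp; grind
    | succ N ih =>
      rw [Finset.sum_range_succ, ← add_assoc, ih (by omega), pathCount_zero_of_le _ (by omega),
        pathCount_zero_of_le _ (by omega)]
      split_ifs <;> omega
  rw [hs n le_rfl] at h
  split_ifs at h ⊢ <;> omega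

/-- The number of short loops at a given vertex. -/
lemma pathCount_self {n v : ℕ} (hv : v < 2 * n + 2) (k : ℕ) (hk : 0 < k) (hk' : k ≤ 2 * n + 2) :
    (pathCount n k v v : ℤ) = (if v = 0 then 1 else 0) +
      if k % 2 = 0 ∧ 2 * n + 2 ≤ k + v then 2 ^ ((k + v - (2 * n + 2)) / 2) else 0 := by
  rcases v with _ | v
  · rcases hk'.lt_or_eq with h | rfl
    · rw [pathCount_zero_of_le _ (by omega), if_pos (by omega), if_pos rfl, if_neg (by omega)]
      simp
    · rw [pathCount_turn (by omega)]
      simp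
  rw [if_neg (by omega), zero_add, pathCount_eq_sub _ _ (by omega)]
  have key : ∀ i ≤ v + 1,
      (pathCount n (2 * n + 2 + i) 0 (v + 1) : ℤ) - pathCount n (2 * n + 1 + i) 0 (v + 1) =
        if (i + v) % 2 = 1 then 2 ^ (i / 2) else 0 := by
    intro i
    induction i using Nat.twoStepInduction with
    | zero =>
      intro hi
      rw [add_zero, add_zero, pathCount_turn (by omega), pathCount_zero_of_le _ (by omega),
        if_pos (show v + 1 ≤ 2 * n + 1 by omega)]
      split_ifs <;> omega
    | one =>
      intro hi
      have h := pathCount_zero_recurrence n 0 (v + 1)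
      rw [zero_add, pathCount_zero_of_le _ le_rfl,
        pathCount_zero_of_le _ (Nat.zero_le _), if_pos (show v + 1 ≤ 2 * n + 1 by omega),
        if_neg (by omega)] at h
      rw [show 2 * n + 2 + 1 = 2 * n + 3 by ring, h, show 2 * n + 1 + 1 = 2 * n + 2 by ring,
        pathCount_turn (by omega)]
      split_ifs <;> omega
    | more i ih _ =>
      intro hi
      have h1 := pathCount_zero_recurrence n (i + 1) (v + 1)
      have h2 := pathCount_zero_recurrence n i (v + 1)
      rw [pathCount_zero_of_le i (by omega), if_neg (by omega)] at h2
      rw [pathCount_zero_of_le (i + 1) (by omega), if_neg (by omega)] at h1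
      rw [show 2 * n + 2 + (i + 2) = i + 1 + 2 * n + 3 by ring, h1,
        show 2 * n + 1 + (i + 2) = i + 2 * n + 3 by ring, h2,
        show i + 1 + 2 * n + 1 = 2 * n + 2 + i by ring,
        show i + 2 * n + 1 = 2 * n + 1 + i by ring]
      have := ih (by omega)
      rw [show (i + 2) / 2 = i / 2 + 1 by omega, show (i + 2 + v) % 2 = (i + v) % 2 by omega,
        pow_succ]
      split_ifs at this ⊢ <;> linarith
  rcases Nat.lt_or_ge (k + v + 1) (2 * n + 2) with h | h
  · rw [pathCount_zero_of_le _ (by omega), pathCount_zero_of_le _ (by omega), if_pos (by omega),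
      if_pos (by omega), if_neg (by omega), sub_self]
  · obtain ⟨i, hi⟩ := Nat.exists_eq_add_of_le h
    rw [show k + v + 1 = 2 * n + 2 + i by omega, show k + v = 2 * n + 1 + i by omega,
      key i (by omega), show k + (v + 1) - (2 * n + 2) = i by omega]
    split_ifs <;> omega

lemma loopCount_short {n k : ℕ} (hk : 0 < k) (hk' : k ≤ 2 * n + 2) :
    loopCount n k = 1 + if k % 2 = 0 then ∑ i ∈ Finset.range k, (2 : ℤ) ^ (i / 2) else 0 := by
  rw [loopCount, Finset.sum_congr rfl fun v hv =>
    pathCount_self (Finset.mem_range.1 hv) k hk hk', Finset.sum_add_distrib]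
  congr 1
  · simp
  split_ifs with h
  · obtain ⟨d, hd⟩ := Nat.exists_eq_add_of_le' hk'
    rw [hd, Finset.sum_range_add, Finset.sum_eq_zero, zero_add]
    · refine Finset.sum_congr rfl fun i _ => ?_
      rw [if_pos (by omega), show k + (d + i) - (d + k) = i by omega]
    · intro i hi
      have := Finset.mem_range.1 hi
      rw [if_neg (by omega)]
  · exact Finset.sum_eq_zero fun i _ => if_neg fun h' => h h'.1

lemma sum_two_pow_half (m : ℕ) :
    ∑ i ∈ Finset.range (2 * m), (2 : ℤ) ^ (i / 2) = 2 ^ (m + 1) - 2 := by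
  induction m with
  | zero => simp
  | succ m ih =>
    rw [show 2 * (m + 1) = 2 * m + 1 + 1 by ring, Finset.sum_range_succ, Finset.sum_range_succ, ih,
      show 2 * m / 2 = m by omega, show (2 * m + 1) / 2 = m by omega]
    ring

lemma loopCount_odd_short {n m : ℕ} (hm : m ≤ n) : loopCount n (2 * m + 1) = 1 := by
  rw [loopCount_short (by omega) (by omega), if_neg (by omega), add_zero]

lemma loopCount_even {n : ℕ} (m : ℕ) (hm : m ≤ 2 * n + 1) :
    loopCount n (2 * m + 2) = 2 ^ (m + 2) - 1 := by
  rcases Nat.lt_or_ge n m with h | h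
  · induction m, h using Nat.le_induction with
    | base =>
      have h1 := loopCount_recurrence n 1
      have h2 := loopCount_short (n := n) (k := 2 * (n + 1)) (by omega) (by omega)
      rw [if_pos (by omega), sum_two_pow_half] at h2
      rw [show 1 + 2 * n + 3 = 2 * (n + 1) + 2 by ring,
        show 1 + 2 * n + 1 = 2 * (n + 1) by ring, h2,
        show 1 = 2 * 0 + 1 by rfl, loopCount_odd_short (Nat.zero_le n)] at h1
      rw [Nat.succ_eq_add_one, show n + 1 = n + (2 * 0 + 1) by rfl, h1]
      ring
    | succ m h ih =>
      obtain ⟨d, rfl⟩ := Nat.exists_eq_add_of_le h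
      have h1 := loopCount_recurrence n (2 * (d + 1) + 1)
      rw [loopCount_odd_short (by omega),
        show 2 * (d + 1) + 1 + 2 * n + 3 = 2 * (n + 1 + d + 1) + 2 by ring,
        show 2 * (d + 1) + 1 + 2 * n + 1 = 2 * (n + 1 + d) + 2 by ring, ih (by omega)] at h1
      rw [h1]
      ring
  · have h2 := loopCount_short (n := n) (k := 2 * (m + 1)) (by omega) (by omega)
    rw [if_pos (by omega), sum_two_pow_half] at h2
    rw [show 2 * m + 2 = 2 * (m + 1) by ring, h2]
    ring

lemma loopCount_odd_long {n : ℕ} (s : ℕ) (hs : s ≤ 2 * n + 2) :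
    loopCount n (2 * s + 2 * n + 3) = 2 ^ s * (2 * n + 3 + 2 * s) + 1 := by
  induction s with
  | zero =>
    have h1 := loopCount_recurrence n 0
    rw [loopCount_zero, zero_add, loopCount_odd_short le_rfl] at h1
    rw [mul_zero, zero_add, h1]
    push_cast
    ring
  | succ s ih =>
    have h1 := loopCount_recurrence n (2 * s + 2)
    rw [loopCount_even s (by omega), show 2 * s + 2 + 2 * n + 1 = 2 * s + 2 * n + 3 by ring,
      ih (by omega)] at h1
    rw [show 2 * (s + 1) + 2 * n + 3 = 2 * s + 2 + 2 * n + 3 by ring, h1]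
    push_cast
    ring

lemma sum_loopCount_even {n : ℕ} (r : ℕ) (hr : r ≤ 2 * n + 2) :
    ∑ l ∈ Finset.range r, loopCount n (2 * l + 2) = 2 ^ (r + 2) - 4 - r := by
  induction r with
  | zero => simp
  | succ r ih =>
    rw [Finset.sum_range_succ, ih (by omega), loopCount_even r (by omega)]
    push_cast
    ring

lemma sum_loopCount_odd_short {n : ℕ} (r : ℕ) (hr : r ≤ n + 1) :
    ∑ l ∈ Finset.range r, loopCount n (2 * l + 1) = r := by
  rw [Finset.sum_congr rfl fun l hl =>
    loopCount_odd_short (by have := Finset.mem_range.1 hl; omega)]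
  simp

lemma sum_loopCount_odd {n : ℕ} (s : ℕ) (hs : s ≤ 2 * n + 2) :
    ∑ l ∈ Finset.range (n + 1 + s), loopCount n (2 * l + 1) =
      n + 1 + s + 2 ^ s * (2 * n + 2 * s - 1) - (2 * n - 1) := by
  induction s with
  | zero => rw [add_zero, sum_loopCount_odd_short _ le_rfl]; push_cast; ring
  | succ s ih =>
    rw [← add_assoc, Finset.sum_range_succ, ih (by omega),
      show 2 * (n + 1 + s) + 1 = 2 * s + 2 * n + 3 by ring, loopCount_odd_long s (by omega)]
    push_cast
    ring

/-- The recurrence of order `4 * n + 4`, in a form without subtraction of indices. -/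
lemma loopCount_long_recurrence (n j : ℕ) :
    loopCount n (j + 1 + (4 * n + 4)) = 3 * loopCount n (j + 1 + (4 * n + 2)) -
      ∑ l ∈ Finset.range (2 * n + 1), loopCount n (j + 1 + 2 * l) := by
  induction j using Nat.twoStepInduction with
  | zero =>
    have h1 := loopCount_odd_long (n := n) (n + 1) (by omega)
    have h2 := loopCount_odd_long (n := n) n (by omega)
    have h3 := sum_loopCount_odd (n := n) n (by omega)
    rw [show 0 + 1 + (4 * n + 4) = 2 * (n + 1) + 2 * n + 3 by ring, h1,
      show 0 + 1 + (4 * n + 2) = 2 * n + 2 * n + 3 by ring, h2]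
    rw [show n + 1 + n = 2 * n + 1 by ring] at h3
    rw [Finset.sum_congr rfl fun l _ => show loopCount n (0 + 1 + 2 * l) = loopCount n (2 * l + 1) by
      ring_nf, h3]
    push_cast
    ring
  | one =>
    have h1 := loopCount_recurrence n (2 * n + 3)
    have h2 := loopCount_even (n := n) (2 * n + 1) (by omega)
    have h3 := sum_loopCount_even (n := n) (2 * n + 1) (by omega)
    have h4 := loopCount_odd_long (n := n) 0 (by omega)
    have h5 := loopCount_even (n := n) (2 * n) (by omega)
    rw [mul_zero, zero_add] at h4
    rw [show 2 * n + 3 + 2 * n + 3 = 1 + 1 + (4 * n + 4) by ring, h4,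
      show 2 * n + 3 + 2 * n + 1 = 2 * (2 * n + 1) + 2 by ring, h2] at h1
    rw [h1, show 1 + 1 + (4 * n + 2) = 2 * (2 * n + 1) + 2 by ring, h2,
      Finset.sum_congr rfl fun l _ => show loopCount n (1 + 1 + 2 * l) = loopCount n (2 * l + 2) by
        ring_nf, h3]
    push_cast
    ring
  | more j ih _ =>
    have h1 := loopCount_recurrence n (j + 2 * n + 4)
    have h2 := loopCount_recurrence n (j + 2 * n + 2)
    have h3 := loopCount_recurrence n (j + 1)
    have h4 : ∑ l ∈ Finset.range (2 * n + 1), loopCount n (j + 2 + 1 + 2 * l) =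
        ∑ l ∈ Finset.range (2 * n + 1), loopCount n (j + 1 + 2 * l) +
          loopCount n (j + 1 + (4 * n + 2)) - loopCount n (j + 1) := by
      have h5 := Finset.sum_range_succ (fun l => loopCount n (j + 1 + 2 * l)) (2 * n + 1)
      rw [Finset.sum_range_succ'] at h5
      rw [show 2 * (2 * n + 1) = 4 * n + 2 by ring, mul_zero, add_zero] at h5
      rw [← h5, add_sub_cancel_right]
      exact Finset.sum_congr rfl fun l _ => by ring_nf
    rw [h4]
    ring_nf at h1 h2 h3 ih ⊢
    linarith

lemma eq_loopCount {n : ℕ} {b : ℕ → ℤ}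
    (hb1 : ∀ m ≤ n, b (2 * m + 1) = 1)
    (hb2 : ∀ s ≤ n, b (2 * s + 2 * n + 3) = 2 ^ s * (2 * n + 3 + 2 * s) + 1)
    (hb3 : ∀ m ≤ 2 * n + 1, b (2 * m + 2) = 2 ^ (m + 2) - 1)
    (hbRec : ∀ j, b (j + 1 + (4 * n + 4)) = 3 * b (j + 1 + (4 * n + 2)) -
      ∑ l ∈ Finset.range (2 * n + 1), b (j + 1 + 2 * l))
    (k : ℕ) (hk : 0 < k) : b k = loopCount n k := by
  induction k using Nat.strong_induction_on with
  | _ k ih =>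
    rcases Nat.lt_or_ge (4 * n + 4) k with h | h
    · obtain ⟨j, rfl⟩ : ∃ j, k = j + 1 + (4 * n + 4) := ⟨k - (4 * n + 5), by omega⟩
      rw [hbRec, loopCount_long_recurrence, ih _ (by omega) (by omega)]
      congr 1
      refine Finset.sum_congr rfl fun l hl => ih _ ?_ (by omega)
      have := Finset.mem_range.1 hl
      omega
    · rcases Nat.even_or_odd' k with ⟨m, rfl | rfl⟩
      · obtain ⟨m, rfl⟩ := Nat.exists_eq_succ_of_ne_zero (show m ≠ 0 by omega)
        rw [show 2 * m.succ = 2 * m + 2 by rfl, hb3 m (by omega), loopCount_even m (by omega)]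
      · rcases Nat.lt_or_ge n m with h' | h'
        · obtain ⟨s, rfl⟩ := Nat.exists_eq_add_of_le h'
          rw [show 2 * (n.succ + s) + 1 = 2 * s + 2 * n + 3 by rw [Nat.succ_eq_add_one]; ring,
            hb2 s (by omega), loopCount_odd_long s (by omega)]
        · rw [hb1 m h', loopCount_odd_short h']

lemma eq_fwd_of_affOn {n : ℕ} {g : ℝ → ℝ}
    (hg1 : g 1 = (n : ℝ) + 2) (hg2 : g 2 = 2 * (n : ℝ) + 3)
    (hg3 : g ((n : ℝ) + 2) = (n : ℝ) + 3) (hg4 : g ((n : ℝ) + 3) = (n : ℝ) + 1)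
    (hg5 : g (2 * (n : ℝ) + 3) = 1)
    (haff1 : AffOn g 1 2) (haff2 : AffOn g 2 ((n : ℝ) + 2))
    (haff3 : AffOn g ((n : ℝ) + 2) ((n : ℝ) + 3))
    (haff4 : AffOn g ((n : ℝ) + 3) (2 * (n : ℝ) + 3)) :
    ∀ u < 2 * n + 2, ∀ x ∈ box n u, g x = fwd n u x := by
  intro u hu x hx
  rcases index_cases hu with rfl | rfl | ⟨m, hm, rfl⟩ | ⟨m, hm, rfl⟩
  · rw [box_zero] at hx
    rw [haff3 x hx, hg3, hg4, fwd_zero]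
    ring
  · rw [box_odd] at hx
    rw [haff1 x ⟨by linarith [hx.1], by linarith [hx.2]⟩, hg1, hg2, fwd_last]
    ring
  · rw [box_even'] at hx
    have hm1 : (m : ℝ) + 1 ≤ n := by exact_mod_cast hm
    have hm0 : (0 : ℝ) ≤ m := m.cast_nonneg
    have hn : (n : ℝ) ≠ 0 := by linarith
    rw [haff4 x ⟨by linarith [hx.1], by linarith [hx.2]⟩, hg4, hg5, fwd_even,
      show 2 * (n : ℝ) + 3 - (n + 3) = n by ring]
    field_simp
    ring
  · rw [box_odd] at hx
    have hm1 : (m : ℝ) + 1 ≤ n := by exact_mod_cast hm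
    have hm0 : (0 : ℝ) ≤ m := m.cast_nonneg
    have hn : ((n : ℝ) + 2) - 2 ≠ 0 := by linarith
    rw [haff2 x ⟨by linarith [hx.1], by linarith [hx.2]⟩, hg2, hg3, fwd_odd _ _ hm]
    field_simp
    ring

end StefanMap

/-- For `n ≥ 1`, the continuous map `g_n : [1, 2n+1] → [1, 2n+1]` has exactly `b_{n,k}`
fixed points of its `k`-th iterate. -/
theorem statement8 (n : ℕ) (hn : 1 ≤ n) (g : ℝ → ℝ)
    (hmaps : Set.MapsTo g (Set.Icc (1 : ℝ) (2 * (n : ℝ) + 1)) (Set.Icc (1 : ℝ) (2 * (n : ℝ) + 1)))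
    (hcont : ContinuousOn g (Set.Icc (1 : ℝ) (2 * (n : ℝ) + 1)))
    (hg1 : g 1 = (n : ℝ) + 1) (hg2 : g 2 = 2 * (n : ℝ) + 1)
    (hg3 : g ((n : ℝ) + 1) = (n : ℝ) + 2) (hg4 : g ((n : ℝ) + 2) = (n : ℝ))
    (hg5 : g (2 * (n : ℝ) + 1) = 1)
    (haff1 : AffOn g 1 2) (haff2 : AffOn g 2 ((n : ℝ) + 1))
    (haff3 : AffOn g ((n : ℝ) + 1) ((n : ℝ) + 2))
    (haff4 : AffOn g ((n : ℝ) + 2) (2 * (n : ℝ) + 1))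
    (b : ℕ → ℤ)
    (hb1 : ∀ k : ℕ, 1 ≤ k → k ≤ n → b (2 * k - 1) = 1)
    (hb2 : ∀ k : ℕ, n + 1 ≤ k → k ≤ 2 * n →
      b (2 * k - 1) = 2 ^ (k - n - 1) * (2 * (k : ℤ) - 1) + 1)
    (hb3 : ∀ k : ℕ, 1 ≤ k → k ≤ 2 * n → b (2 * k) = 2 ^ (k + 1) - 1)
    (hbRec : ∀ k : ℕ, 4 * n + 1 ≤ k →
      b k = 3 * b (k - 2) - ∑ i ∈ Finset.Icc 2 (2 * n), b (k - 2 * i))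
    (k : ℕ) (hk : 0 < k) :
    {x ∈ Set.Icc (1 : ℝ) (2 * (n : ℝ) + 1) | g^[k] x = x}.Finite ∧
      ({x ∈ Set.Icc (1 : ℝ) (2 * (n : ℝ) + 1) | g^[k] x = x}.ncard : ℤ) = b k := by
  obtain ⟨n, rfl⟩ : ∃ m, n = m + 1 := ⟨n - 1, by omega⟩
  have e1 : ((n + 1 : ℕ) : ℝ) = n + 1 := by push_cast; ring
  have e2 : (n : ℝ) + 1 + 1 = n + 2 := by ring
  have e3 : (n : ℝ) + 1 + 2 = n + 3 := by ring
  have e4 : 2 * ((n : ℝ) + 1) + 1 = 2 * n + 3 := by ring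
  simp only [e1, e2, e3, e4] at *
  obtain ⟨hfin, hcard⟩ := StefanMap.fixedPoints_iterate_card
    (StefanMap.eq_fwd_of_affOn hg1 hg2 hg3 hg4 hg5 haff1 haff2 haff3 haff4) hk
  refine ⟨hfin, ?_⟩
  rw [hcard, StefanMap.eq_loopCount (n := n) (b := b) (fun m hm => ?_) (fun s hs => ?_) (fun m hm => ?_)
    (fun j => ?_) k hk, StefanMap.loopCount]
  · push_cast
    rfl
  · have h := hb1 (m + 1) (by omega) (by omega)
    rwa [show 2 * (m + 1) - 1 = 2 * m + 1 by omega] at h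
  · have h := hb2 (n + 2 + s) (by omega) (by omega)
    rw [show 2 * (n + 2 + s) - 1 = 2 * s + 2 * n + 3 by omega,
      show n + 2 + s - (n + 1) - 1 = s by omega] at h
    rw [h]
    push_cast
    ring
  · exact hb3 (m + 1) (by omega) (by omega)
  · have h := hbRec (j + 1 + (4 * n + 4)) (by omega)
    rw [h, show j + 1 + (4 * n + 4) - 2 = j + 1 + (4 * n + 2) by omega]
    congr 1
    refine Finset.sum_nbij' (fun i => 2 * n + 2 - i) (fun l => 2 * n + 2 - l) ?_ ?_ ?_ ?_ ?_ <;>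
      intro i hi <;> simp only [Finset.mem_Icc, Finset.mem_range] at hi ⊢
    · omega
    · omega
    · omega
    · omega
    · congr 1
      omega
end

section
/- For every integer n ≥ 1 and every positive integer k, Φ₁(k, φ_{b_n}) ≡ 0 (mod k), where φ_{b_n}(k) = b_{n,k}. -/
open scoped Classical

open PowerSeries in
/-- `F` has constant coefficient `1` and `-X F' / F = Q`. -/
def HasNegLogDeriv (F Q : PowerSeries ℤ) : Prop :=
  constantCoeff F = 1 ∧ X * derivative ℤ F = -(Q * F)

namespace HasNegLogDeriv

open PowerSeries

theorem mul {F G P Q : PowerSeries ℤ} (hF : HasNegLogDeriv F P) (hG : HasNegLogDeriv G Q) :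
    HasNegLogDeriv (F * G) (P + Q) := by
  refine ⟨by simp [hF.1, hG.1], ?_⟩
  rw [Derivation.leibniz, smul_eq_mul, smul_eq_mul]
  linear_combination G * hF.2 + F * hG.2

theorem inv {F Q : PowerSeries ℤ} (hF : HasNegLogDeriv F Q) :
    ∃ G, HasNegLogDeriv G (-Q) := by
  have h1 : F * invOfUnit F 1 = 1 := mul_invOfUnit F 1 (by simp [hF.1])
  refine ⟨invOfUnit F 1, by simp [constantCoeff_invOfUnit], ?_⟩
  have h2 := congrArg (derivative ℤ) h1
  rw [Derivation.leibniz, smul_eq_mul, smul_eq_mul, Derivation.map_one_eq_zero] at h2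
  linear_combination (X * invOfUnit F 1) * h2 - (invOfUnit F 1) ^ 2 * hF.2
    - (X * derivative ℤ (invOfUnit F 1) - Q * invOfUnit F 1) * h1

theorem zpow {F Q : PowerSeries ℤ} (hF : HasNegLogDeriv F Q) (a : ℤ) :
    ∃ G, HasNegLogDeriv G (a • Q) := by
  induction a with
  | zero => exact ⟨1, by simp [HasNegLogDeriv, Derivation.map_one_eq_zero]⟩
  | succ i ih =>
    obtain ⟨G, hG⟩ := ih
    exact ⟨G * F, by simpa only [add_smul, one_smul] using hG.mul hF⟩
  | pred i ih =>
    obtain ⟨G, hG⟩ := ih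
    obtain ⟨H, hH⟩ := hF.inv
    refine ⟨G * H, ?_⟩
    rw [sub_smul, one_smul, sub_eq_add_neg]
    exact hG.mul hH

end HasNegLogDeriv

/-- The indicator series of the positive multiples of `j`. -/
def multiplesSeries (j : ℕ) : PowerSeries ℤ :=
  PowerSeries.mk fun k => if 0 < k ∧ j ∣ k then 1 else 0

open PowerSeries in
theorem multiplesSeries_mul_one_sub (j : ℕ) (hj : 0 < j) :
    multiplesSeries j * (1 - X ^ j) = X ^ j := by
  ext k
  rw [mul_sub, mul_one, map_sub, coeff_mul_X_pow', coeff_X_pow]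
  simp only [multiplesSeries, coeff_mk]
  by_cases hk : j ≤ k
  · obtain ⟨i, rfl⟩ := Nat.exists_eq_add_of_le hk
    rcases Nat.eq_zero_or_pos i with rfl | hi
    · simp [hj]
    · have : j + i ≠ j := by omega
      simp [hi, hi.ne']
  · have h1 : ¬ (0 < k ∧ j ∣ k) := fun h => hk (Nat.le_of_dvd h.1 h.2)
    have h2 : k ≠ j := by omega
    simp [hk, h1, h2]

open PowerSeries in
theorem hasNegLogDeriv_one_sub_X_pow (j : ℕ) (hj : 0 < j) :
    HasNegLogDeriv (1 - X ^ j) ((j : ℤ) • multiplesSeries j) := by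
  refine ⟨by simp [hj.ne'], ?_⟩
  obtain ⟨i, rfl⟩ := Nat.exists_eq_succ_of_ne_zero hj.ne'
  rw [smul_mul_assoc, multiplesSeries_mul_one_sub _ hj, map_sub,
    Derivation.map_one_eq_zero, Derivation.leibniz_pow]
  simp [derivative_X, zsmul_eq_mul]
  ring

theorem sum_divisors_Phi1_s9 (φ : ℕ → ℤ) (m : ℕ) (hm : 0 < m) :
    ∑ d ∈ m.divisors, Phi1 d φ = φ m := by
  refine (ArithmeticFunction.sum_eq_iff_sum_mul_moebius_eq (R := ℤ)
    (f := fun d => Phi1 d φ) (g := φ)).2 (fun k _ => ?_) m hm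
  rw [Phi1, Finset.sum_filter]
  refine (Nat.sum_divisorsAntidiagonal
    fun x y => (ArithmeticFunction.moebius x : ℤ) * φ y).trans ?_
  refine Finset.sum_congr rfl fun d _ => ?_
  split_ifs with h
  · simp
  · simp [ArithmeticFunction.moebius_eq_zero_of_not_squarefree h]

open PowerSeries in
/-- The Gauss congruences for the coefficients of `-X F' / F`, with `F` an integral power series
of constant coefficient `1`. -/
theorem HasNegLogDeriv.dvd_Phi1 {F Q : PowerSeries ℤ} (hF : HasNegLogDeriv F Q)
    (m : ℕ) : (m + 1 : ℤ) ∣ Phi1 (m + 1) (fun k => coeff k Q) := by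
  set g : ℕ → ℤ := fun j => Phi1 j fun k => coeff k Q with hg
  have step : ∀ (m : ℕ) (G : PowerSeries ℤ),
      HasNegLogDeriv G (Q - ∑ j ∈ Finset.Icc 1 m, g j • multiplesSeries j) →
      g (m + 1) = (m + 1) * -coeff (m + 1) G := by
    intro m G hG
    set C := Q - ∑ j ∈ Finset.Icc 1 m, g j • multiplesSeries j with hC
    have hcoeff : ∀ k, 0 < k → coeff k C =
        ∑ d ∈ k.divisors, g d - ∑ d ∈ k.divisors with d ≤ m, g d := by
      intro k hk
      rw [hg, sum_divisors_Phi1_s9 _ k hk, hC, map_sub, map_sum]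
      congr 1
      simp only [map_zsmul, multiplesSeries, coeff_mk, smul_eq_mul, hk, true_and, mul_ite, mul_one,
        mul_zero]
      rw [← Finset.sum_filter]
      refine Finset.sum_congr ?_ fun _ _ => rfl
      ext d
      simp only [Finset.mem_filter, Finset.mem_Icc, Nat.mem_divisors]
      constructor
      · rintro ⟨⟨_, h1⟩, h2⟩
        exact ⟨⟨h2, hk.ne'⟩, h1⟩
      · rintro ⟨⟨h2, _⟩, h1⟩
        exact ⟨⟨Nat.pos_of_dvd_of_pos h2 hk, h1⟩, h2⟩
    have hzero : coeff 0 C = 0 := by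
      have := congrArg (coeff 0) hG.2
      simpa [hG.1] using this
    have hlow : ∀ k, k ≤ m → coeff k C = 0 := by
      intro k hkm
      rcases Nat.eq_zero_or_pos k with rfl | hk
      · exact hzero
      · rw [hcoeff k hk, Finset.filter_true_of_mem, sub_self]
        exact fun d hd => (Nat.divisor_le hd).trans hkm
    have htop : coeff (m + 1) C = g (m + 1) := by
      have hfilter : {d ∈ (m + 1).divisors | d ≤ m} = (m + 1).divisors.erase (m + 1) := by
        ext d
        simp only [Finset.mem_filter, Finset.mem_erase]
        constructor
        · rintro ⟨h1, h2⟩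
          exact ⟨by omega, h1⟩
        · rintro ⟨h1, h2⟩
          have := Nat.divisor_le h2
          exact ⟨h2, by omega⟩
      rw [hcoeff _ m.succ_pos, hfilter, sub_eq_iff_eq_add,
        Finset.add_sum_erase _ _ (Nat.mem_divisors_self _ m.succ_ne_zero)]
    have h := congrArg (coeff (m + 1)) hG.2
    rw [coeff_succ_X_mul, coeff_derivative, map_neg, coeff_mul, 
      Finset.sum_eq_single (m + 1, 0)] at h
    · rw [htop, coeff_zero_eq_constantCoeff_apply, hG.1] at h
      linear_combination h
    · rintro ⟨i, j⟩ hij hne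
      replace hij := Finset.HasAntidiagonal.mem_antidiagonal.1 hij
      rw [hlow i, zero_mul]
      by_contra hi
      exact hne (by ext <;> simp <;> simp at hij <;> omega)
    · simp
  have exists_series : ∀ m, ∃ G,
      HasNegLogDeriv G (Q - ∑ j ∈ Finset.Icc 1 m, g j • multiplesSeries j) := by
    intro m
    induction m with
    | zero => exact ⟨F, by simpa using hF⟩
    | succ m ih =>
      obtain ⟨G, hG⟩ := ih
      obtain ⟨H, hH⟩ := (hasNegLogDeriv_one_sub_X_pow (m + 1) m.succ_pos).zpow (coeff (m + 1) G)
      refine ⟨G * H, ?_⟩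
      convert hG.mul hH using 1
      rw [Finset.sum_Icc_succ_top (by omega), step m G hG, smul_smul]
      push_cast
      rw [show ((m : ℤ) + 1) * -coeff (m + 1) G = -(coeff (m + 1) G * (m + 1)) by ring, neg_smul]
      abel
  obtain ⟨G, hG⟩ := exists_series m
  exact ⟨_, step m G hG⟩

/-- The sequence satisfies the recurrence with characteristic polynomial
`x ^ (2n+1) - 2 x ^ (2n-1) - 1`. -/
theorem short_recurrence (n : ℕ) (hn : 1 ≤ n) (b : ℕ → ℤ)
    (hb1 : ∀ k : ℕ, 1 ≤ k → k ≤ n → b (2 * k - 1) = 1)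
    (hb2 : ∀ k : ℕ, n + 1 ≤ k → k ≤ 2 * n →
      b (2 * k - 1) = 2 ^ (k - n - 1) * (2 * (k : ℤ) - 1) + 1)
    (hb3 : ∀ k : ℕ, 1 ≤ k → k ≤ 2 * n → b (2 * k) = 2 ^ (k + 1) - 1)
    (hbRec : ∀ k : ℕ, 4 * n + 1 ≤ k →
      b k = 3 * b (k - 2) - ∑ i ∈ Finset.Icc 2 (2 * n), b (k - 2 * i))
    (k : ℕ) (hk : 2 * n + 1 < k) :
    b k = 2 * b (k - 2) + b (k - (2 * n + 1)) := by
  have sum_shift : ∀ r, ∑ i ∈ Finset.Icc 2 (2 * n), b (4 * n + r - 2 * i) =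
      ∑ j ∈ Finset.range (2 * n - 1), b (2 * j + r) := by
    intro r
    refine Finset.sum_bij' (fun i _ => 2 * n - i) (fun j _ => 2 * n - j) ?_ ?_ ?_ ?_ ?_ <;>
      simp only [Finset.mem_Icc, Finset.mem_range] <;> intro i hi
    · omega
    · omega
    · omega
    · omega
    · congr 1; omega
  have telescope : ∀ k M, 1 ≤ M → ∑ i ∈ Finset.Icc 2 M, b (k - 2 * i) + b (k - 2 - 2 * M) =
      b (k - 4) + ∑ i ∈ Finset.Icc 2 M, b (k - 2 - 2 * i) := by
    intro k M hM
    induction M, hM using Nat.le_induction with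
    | base => simp [Nat.sub_sub]
    | succ M hM ih =>
      rw [Finset.sum_Icc_succ_top (by omega), Finset.sum_Icc_succ_top (by omega),
        show k - 2 * (M + 1) = k - 2 - 2 * M by omega]
      linear_combination ih
  have sum_even : ∀ M, M ≤ 2 * n →
      ∑ j ∈ Finset.range M, b (2 * j + 2) = 2 ^ (M + 2) - 4 - M := by
    intro M hM
    induction M with
    | zero => simp
    | succ M ih =>
      rw [Finset.sum_range_succ, ih (by omega), show 2 * M + 2 = 2 * (M + 1) by ring,
        hb3 (M + 1) (by omega) hM]
      push_cast
      ring
  have sum_odd_low : ∀ M, M ≤ n → ∑ j ∈ Finset.range M, b (2 * j + 1) = M := by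
    intro M hM
    induction M with
    | zero => simp
    | succ M ih =>
      rw [Finset.sum_range_succ, ih (by omega), show 2 * M + 1 = 2 * (M + 1) - 1 by omega,
        hb1 (M + 1) (by omega) hM]
      push_cast
      ring
  have sum_odd : ∀ r, r ≤ n → ∑ j ∈ Finset.range (n + r), b (2 * j + 1) =
      2 ^ r * (2 * n + 2 * r - 3) + r - n + 3 := by
    intro r hr
    induction r with
    | zero =>
      rw [add_zero, sum_odd_low n le_rfl]
      push_cast
      ring
    | succ r ih =>
      rw [← add_assoc, Finset.sum_range_succ, ih (by omega),
        show 2 * (n + r) + 1 = 2 * (n + r + 1) - 1 by omega,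
        hb2 (n + r + 1) (by omega) (by omega), show n + r + 1 - n - 1 = r by omega]
      push_cast
      ring
  have far : ∀ k, 4 * n + 2 < k → (∀ l < k, 2 * n + 1 < l →
      b l = 2 * b (l - 2) + b (l - (2 * n + 1))) →
      b k = 2 * b (k - 2) + b (k - (2 * n + 1)) := by
    intro k hk4 ih
    have r1 := hbRec k (by omega)
    have r2 := hbRec (k - 2) (by omega)
    have t := telescope k (2 * n) (by omega)
    have i1 := ih (k - 2) (by omega) (by omega)
    have i2 := ih (k - (2 * n + 1)) (by omega) (by omega)
    rw [show k - 2 - 2 = k - 4 by omega] at r2 i1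
    rw [show k - (2 * n + 1) - 2 = k - 2 - (2 * n + 1) by omega,
      show k - (2 * n + 1) - (2 * n + 1) = k - 2 - 2 * (2 * n) by omega] at i2
    linear_combination r1 - r2 - t + 2 * i1 - i2
  induction k using Nat.strong_induction_on with
  | _ k ih =>
  obtain ⟨j, rfl | rfl⟩ := Nat.even_or_odd' k
  · -- even indices
    rcases le_or_gt j (2 * n) with hj | hj
    · have e1 := hb3 j (by omega) hj
      have e2 := hb3 (j - 1) (by omega) (by omega)
      have e3 := hb1 (j - n) (by omega) (by omega)
      rw [show 2 * (j - 1) = 2 * j - 2 by omega, show j - 1 + 1 = j by omega] at e2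
      rw [show 2 * (j - n) - 1 = 2 * j - (2 * n + 1) by omega] at e3
      rw [e1, e2, e3]
      ring
    · rcases (show j = 2 * n + 1 ∨ 2 * n + 1 < j by omega) with rfl | hj'
      · have r := hbRec (2 * (2 * n + 1)) (by omega)
        rw [show 2 * (2 * n + 1) = 4 * n + 2 by ring, sum_shift 2, sum_even _ (by omega)] at r
        have e2 := hb3 (2 * n) (by omega) le_rfl
        have e3 := hb2 (n + 1) le_rfl (by omega)
        rw [show 2 * (2 * n) = 4 * n by ring] at e2
        rw [show 2 * (n + 1) - 1 = 2 * n + 1 by omega, show n + 1 - n - 1 = 0 by omega] at e3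
        rw [show 2 * (2 * n + 1) = 4 * n + 2 by ring, r, show 4 * n + 2 - 2 = 4 * n by omega,
          show 4 * n + 2 - (2 * n + 1) = 2 * n + 1 by omega, e2, e3,
          show 2 * n - 1 + 2 = 2 * n + 1 by omega, Nat.cast_sub (by omega)]
        push_cast
        ring
      · exact far _ (by omega) ih
  · -- odd indices
    rcases lt_or_ge j (2 * n) with hj | hj
    · obtain ⟨i, rfl⟩ := Nat.exists_eq_add_of_le (show n + 1 ≤ j by omega)
      have e1 := hb2 (n + 1 + i + 1) (by omega) (by omega)
      have e2 := hb2 (n + 1 + i) (by omega) (by omega)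
      have e3 := hb3 (i + 1) (by omega) (by omega)
      rw [show 2 * (n + 1 + i + 1) - 1 = 2 * (n + 1 + i) + 1 by omega,
        show n + 1 + i + 1 - n - 1 = i + 1 by omega] at e1
      rw [show n + 1 + i - n - 1 = i by omega] at e2
      rw [show 2 * (n + 1 + i) + 1 - 2 = 2 * (n + 1 + i) - 1 by omega,
        show 2 * (n + 1 + i) + 1 - (2 * n + 1) = 2 * (i + 1) by omega, e1, e2, e3]
      push_cast
      ring
    · rcases hj.eq_or_lt with rfl | hj'
      · obtain ⟨m, rfl⟩ := Nat.exists_eq_add_of_le' hn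
        have r := hbRec (4 * (m + 1) + 1) le_rfl
        have e2 := hb2 (2 * (m + 1)) (by omega) le_rfl
        have e3 := hb3 (m + 1) (by omega) (by omega)
        rw [sum_shift 1, show 2 * (m + 1) - 1 = m + 1 + m by omega, sum_odd m (by omega)] at r
        rw [show 2 * (2 * (m + 1)) - 1 = 4 * (m + 1) + 1 - 2 by omega,
          show 2 * (m + 1) - (m + 1) - 1 = m by omega] at e2
        rw [show 2 * (2 * (m + 1)) + 1 = 4 * (m + 1) + 1 by ring, r, e2,
          show 4 * (m + 1) + 1 - (2 * (m + 1) + 1) = 2 * (m + 1) by omega, e3]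
        push_cast
        ring
      · exact far _ (by omega) ih

open PowerSeries in
theorem hasNegLogDeriv_one_add_X :
    HasNegLogDeriv (1 + X) (mk fun k => if k = 0 then 0 else (-1) ^ k) := by
  refine ⟨by simp, ?_⟩
  have h : (mk fun k => if k = 0 then 0 else (-1) ^ k) * (1 + X) = (-X : PowerSeries ℤ) := by
    ext k
    rw [mul_add, mul_one, map_add, map_neg, coeff_X]
    rcases k with _ | _ | k
    · simp
    · simp [coeff_succ_mul_X]
    · simp [coeff_succ_mul_X, pow_succ]
  rw [h, map_add, Derivation.map_one_eq_zero, derivative_X]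
  ring

theorem Phi1_congr {φ ψ : ℕ → ℤ} {m : ℕ} (h : ∀ k, 0 < k → φ k = ψ k) :
    Phi1 m φ = Phi1 m ψ := by
  refine Finset.sum_congr rfl fun d hd => ?_
  rw [h _ (Nat.div_pos (Nat.divisor_le (Finset.mem_filter.1 hd).1)
    (Nat.pos_of_mem_divisors (Finset.mem_filter.1 hd).1))]

open PowerSeries in
theorem hasNegLogDeriv_of_recurrence (n : ℕ) (hn : 1 ≤ n) (q : ℕ → ℤ)
    (hodd : ∀ k, k < n → q (2 * k + 1) = 0) (heven : ∀ k, 1 ≤ k → k ≤ n → q (2 * k) = 2 ^ (k + 1))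
    (htop : q (2 * n + 1) = 2 * n + 1)
    (hrec : ∀ k, 2 * n + 1 < k → q k = 2 * q (k - 2) + q (k - (2 * n + 1))) :
    HasNegLogDeriv (1 - C (2 : ℤ) * X ^ 2 - X ^ (2 * n + 1)) (mk fun k => if k = 0 then 0 else q k) := by
  refine ⟨by simp, ?_⟩
  have hd : X * derivative ℤ (1 - C (2 : ℤ) * X ^ 2 - X ^ (2 * n + 1)) =
      -(C (4 : ℤ) * X ^ 2 + C (2 * n + 1 : ℤ) * X ^ (2 * n + 1)) := by
    rw [map_sub, map_sub, Derivation.leibniz, derivative_C]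
    simp [Derivation.leibniz_pow, derivative_X]
    ring
  rw [hd, neg_inj]
  ext k
  rw [mul_sub, mul_sub, mul_one, mul_left_comm, map_add, coeff_C_mul_X_pow, coeff_C_mul_X_pow]
  simp only [map_sub, coeff_C_mul, coeff_mul_X_pow', coeff_mk]
  rcases lt_trichotomy k (2 * n + 1) with hk | rfl | hk
  · rw [if_neg hk.ne, if_neg hk.not_ge]
    obtain ⟨j, rfl | rfl⟩ := Nat.even_or_odd' k
    · rcases j with _ | _ | j
      · simp
      · have := heven 1 le_rfl hn
        simp_all
      · have e1 := heven (j + 2) (by omega) (by omega)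
        have e2 := heven (j + 1) (by omega) (by omega)
        rw [if_neg (by omega), if_neg (by omega), if_pos (by omega), if_neg (by omega),
          show 2 * (j + 1 + 1) - 2 = 2 * (j + 1) by omega, e1, e2]
        ring
    · rcases j with _ | j
      · have := hodd 0 hn
        simp_all
      · have e1 := hodd (j + 1) (by omega)
        have e2 := hodd j (by omega)
        rw [if_neg (by omega), if_neg (by omega), if_pos (by omega), if_neg (by omega),
          show 2 * (j + 1) + 1 - 2 = 2 * j + 1 by omega, e1, e2]
        ring
  · obtain ⟨j, rfl⟩ := Nat.exists_eq_add_of_le' hn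
    have e2 := hodd j (by omega)
    rw [if_neg (by omega), if_pos rfl, if_neg (by omega), if_pos (by omega), if_neg (by omega),
      if_pos le_rfl, if_pos (by omega), htop, show 2 * (j + 1) + 1 - 2 = 2 * j + 1 by omega, e2]
    ring
  · rw [if_neg (by omega), if_neg (by omega), if_neg (by omega), if_pos (by omega),
      if_neg (by omega), if_pos (by omega), if_neg (by omega), hrec k hk]
    ring

/-- For `n ≥ 1` and the sequence `b_{n,k}`, `Φ₁(k, b_n) ≡ 0 (mod k)`. -/
theorem statement9 (n : ℕ) (hn : 1 ≤ n) (b : ℕ → ℤ)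
    (hb1 : ∀ k : ℕ, 1 ≤ k → k ≤ n → b (2 * k - 1) = 1)
    (hb2 : ∀ k : ℕ, n + 1 ≤ k → k ≤ 2 * n →
      b (2 * k - 1) = 2 ^ (k - n - 1) * (2 * (k : ℤ) - 1) + 1)
    (hb3 : ∀ k : ℕ, 1 ≤ k → k ≤ 2 * n → b (2 * k) = 2 ^ (k + 1) - 1)
    (hbRec : ∀ k : ℕ, 4 * n + 1 ≤ k →
      b k = 3 * b (k - 2) - ∑ i ∈ Finset.Icc 2 (2 * n), b (k - 2 * i))
    (k : ℕ) (hk : 0 < k) :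
    (k : ℤ) ∣ Phi1 k b := by
  obtain ⟨m, rfl⟩ := Nat.exists_eq_succ_of_ne_zero hk.ne'
  have hP := hasNegLogDeriv_of_recurrence n hn (fun k => b k + (-1) ^ k) ?_ ?_ ?_ ?_
  · obtain ⟨H, hH⟩ := hasNegLogDeriv_one_add_X.inv
    have h := (hP.mul hH).dvd_Phi1 m
    rw [Phi1_congr (ψ := b)] at h
    · exact_mod_cast h
    · intro k hk
      simp [hk.ne']
  · intro j hj
    have h := hb1 (j + 1) (by omega) (by omega)
    rw [show 2 * (j + 1) - 1 = 2 * j + 1 by omega] at h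
    simp [h, pow_succ]
  · intro j hj hjn
    simp [hb3 j hj (by omega)]
  · have h := hb2 (n + 1) le_rfl (by omega)
    rw [show 2 * (n + 1) - 1 = 2 * n + 1 by omega, show n + 1 - n - 1 = 0 by omega] at h
    simp only [h, Odd.neg_one_pow ⟨n, rfl⟩]
    push_cast
    ring
  · intro j hj
    obtain ⟨i, rfl⟩ := Nat.exists_eq_add_of_le hj.le
    have h := short_recurrence n hn b hb1 hb2 hb3 hbRec _ hj
    have e : (-1 : ℤ) ^ (2 * n + 1 + i) = (-1) ^ (2 * n + 1 + i - 2) := by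
      rw [show 2 * n + 1 + i = 2 * n + 1 + i - 2 + 2 by omega, pow_add]
      simp
    have e' : (-1 : ℤ) ^ (2 * n + 1 + i) = -(-1) ^ i := by
      rw [pow_add, Odd.neg_one_pow ⟨n, rfl⟩, neg_one_mul]
    rw [Nat.add_sub_cancel_left] at h ⊢
    linear_combination h + 2 * e - e'
end
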